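/- For every real number α with 1 < α < 2, there exists a C^∞ μ-preserving diffeomorphism T of the torus T² that is ergodic with respect to μ and such that the set NB_α of all points of T² that are NOT generic points of T for μ satisfies α − 1 ≤ dim_H(NB_α) ≤ α and μ(NB_α) = 0, where dim_H denotes Hausdorff dimension. -/

import Mathlib

open MeasureTheory Filter Topology
open scoped ENNReal
noncomputable section

abbrev Torus2 := UnitAddCircle × UnitAddCircle

/-- Canonical projection `ℝ² → 𝕋²`. -/
def torusProj : ℝ × ℝ → Torus2 := fun p => ((p.1 : UnitAddCircle), (p.2 : UnitAddCircle))

/-- `F : ℝ² → ℝ²` is a lift of `f : 𝕋² → 𝕋²`. -/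
def IsLift (F : ℝ × ℝ → ℝ × ℝ) (f : Torus2 → Torus2) : Prop :=
  ∀ p : ℝ × ℝ, torusProj (F p) = f (torusProj p)

/-- `F` commutes with integer translations. -/
def IntEquivariant (F : ℝ × ℝ → ℝ × ℝ) : Prop :=
  ∀ p : ℝ × ℝ, ∀ m : ℤ × ℤ, F (p + ((m.1 : ℝ), (m.2 : ℝ))) = F p + ((m.1 : ℝ), (m.2 : ℝ))

/-- A C^∞ measure-preserving diffeomorphism of the torus 𝕋². -/
structure SmoothMPTorusDiffeo where
  toEquiv : Torus2 ≃ Torus2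
  lift : ℝ × ℝ → ℝ × ℝ
  liftInv : ℝ × ℝ → ℝ × ℝ
  lift_contDiff : ContDiff ℝ (⊤ : ℕ∞) lift
  liftInv_contDiff : ContDiff ℝ (⊤ : ℕ∞) liftInv
  lift_equivariant : IntEquivariant lift
  liftInv_equivariant : IntEquivariant liftInv
  lift_isLift : IsLift lift toEquiv
  liftInv_isLift : IsLift liftInv toEquiv.symm
  measurePreserving : MeasurePreserving toEquiv volume volume

/-- generic point -/
def IsGenericPt (T : Torus2 → Torus2) (ν : Measure Torus2) (x : Torus2) : Prop :=
  ∀ f : C(Torus2, ℝ),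
    Tendsto (fun N : ℕ => (N : ℝ)⁻¹ * ∑ i ∈ Finset.range N, f (T^[i] x)) atTop
      (𝓝 (∫ y, f y ∂ν))

def IsMinimalMap (T : Torus2 → Torus2) : Prop :=
  ∀ x : Torus2, Dense (Set.range fun n : ℕ => T^[n] x)

def IsWeakMixingWrt (T : Torus2 → Torus2) (ν : Measure Torus2) : Prop :=
  ∃ m : ℕ → ℕ, StrictMono m ∧ ∀ A B : Set Torus2, MeasurableSet A → MeasurableSet B →
    Tendsto (fun n => |(ν (B ∩ (T^[m n]) ⁻¹' A)).toReal - (ν A).toReal * (ν B).toReal|)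
      atTop (𝓝 0)

/-- Lift of the translation `S_t`. -/
def Slift (t : ℝ) : ℝ × ℝ → ℝ × ℝ := fun p => (p.1 + t, p.2)

/-- `T` is ergodic with respect to `ν`: every Borel set `E` with `T⁻¹E = E` has measure `0` or `1`. -/
def IsErgodicWrt (T : Torus2 → Torus2) (ν : Measure Torus2) : Prop :=
  ∀ E : Set Torus2, MeasurableSet E → T ⁻¹' E = E → ν E = 0 ∨ ν E = 1

/-! ### Part 1: lifted diffeomorphisms, shears -/

def zc (m : ℤ × ℤ) : ℝ × ℝ := ((m.1 : ℝ), (m.2 : ℝ))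

structure LD where
  e : Torus2 ≃ Torus2
  H : ℝ × ℝ → ℝ × ℝ
  Hi : ℝ × ℝ → ℝ × ℝ
  M : ℤ × ℤ → ℤ × ℤ
  Mi : ℤ × ℤ → ℤ × ℤ
  hH : ContDiff ℝ (⊤ : ℕ∞) H
  hHi : ContDiff ℝ (⊤ : ℕ∞) Hi
  HM : ∀ p m, H (p + zc m) = H p + zc (M m)
  HiM : ∀ p m, Hi (p + zc m) = Hi p + zc (Mi m)
  MMi : ∀ m, M (Mi m) = m
  lift : IsLift H e
  lifti : IsLift Hi e.symm
  mp : MeasurePreserving e volume volume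
  lip : ∃ K, LipschitzWith K e

namespace LD

def comp (g f : LD) : LD where
  e := f.e.trans g.e
  H := fun p => g.H (f.H p)
  Hi := fun p => f.Hi (g.Hi p)
  M := fun m => g.M (f.M m)
  Mi := fun m => f.Mi (g.Mi m)
  hH := g.hH.comp f.hH
  hHi := f.hHi.comp g.hHi
  HM := fun p m => by rw [f.HM, g.HM]
  HiM := fun p m => by rw [g.HiM, f.HiM]
  MMi := fun m => by rw [f.MMi, g.MMi]
  lift := fun p => by rw [g.lift, f.lift]; rfl
  lifti := fun p => by rw [f.lifti, g.lifti]; rfl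
  mp := g.mp.comp f.mp
  lip := by
    obtain ⟨K, hK⟩ := g.lip
    obtain ⟨K', hK'⟩ := f.lip
    exact ⟨K * K', hK.comp hK'⟩

@[simp] lemma comp_e (g f : LD) (z : Torus2) : (g.comp f).e z = g.e (f.e z) := rfl
@[simp] lemma comp_H (g f : LD) (z : ℝ × ℝ) : (g.comp f).H z = g.H (f.H z) := rfl

def one : LD where
  e := Equiv.refl _
  H := id
  Hi := id
  M := id
  Mi := id
  hH := contDiff_id
  hHi := contDiff_id
  HM := fun _ _ => rfl
  HiM := fun _ _ => rfl
  MMi := fun _ => rfl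
  lift := fun _ => rfl
  lifti := fun _ => rfl
  mp := MeasurePreserving.id _
  lip := ⟨1, LipschitzWith.id⟩

def swp : LD where
  e := Equiv.prodComm _ _
  H := Prod.swap
  Hi := Prod.swap
  M := Prod.swap
  Mi := Prod.swap
  hH := contDiff_snd.prodMk contDiff_fst
  hHi := contDiff_snd.prodMk contDiff_fst
  HM := fun _ _ => rfl
  HiM := fun _ _ => rfl
  MMi := fun _ => rfl
  lift := fun _ => rfl
  lifti := fun _ => rfl
  mp := Measure.measurePreserving_swap
  lip := ⟨1, by
    intro x y
    simp [Prod.edist_eq, max_comm]⟩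

end LD

lemma exists_real_rep (x y : UnitAddCircle) :
    ∃ a b : ℝ, (a : UnitAddCircle) = x ∧ (b : UnitAddCircle) = y ∧ |a - b| = dist x y := by
  obtain ⟨a, rfl⟩ := QuotientAddGroup.mk_surjective x
  obtain ⟨b, rfl⟩ := QuotientAddGroup.mk_surjective y
  refine ⟨a - round (a - b), b, ?_, rfl, ?_⟩
  · have : ((a - round (a - b) : ℝ) : UnitAddCircle) = (a : UnitAddCircle) - ((round (a-b) : ℝ) : UnitAddCircle) := rfl
    rw [this]
    have h2 : ((round (a-b) : ℝ) : UnitAddCircle) = 0 := by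
      rw [AddCircle.coe_eq_zero_iff]
      exact ⟨round (a-b), by simp⟩
    rw [h2, sub_zero]
  · rw [dist_eq_norm]
    have : (QuotientAddGroup.mk a - QuotientAddGroup.mk b : UnitAddCircle) = ((a - b : ℝ) : UnitAddCircle) := rfl
    rw [this, UnitAddCircle.norm_eq]
    congr 1; ring

lemma dist_coe_le (a b : ℝ) : dist (a : UnitAddCircle) (b : UnitAddCircle) ≤ |a - b| := by
  rw [dist_eq_norm]
  have : ((a : UnitAddCircle) - (b : UnitAddCircle)) = ((a - b : ℝ) : UnitAddCircle) := rfl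
  rw [this]
  rw [UnitAddCircle.norm_eq]
  simpa using round_le (a - b) 0

lemma coe_int_zero (n : ℤ) : ((n : ℝ) : UnitAddCircle) = 0 := by
  rw [AddCircle.coe_eq_zero_iff]
  exact ⟨n, by simp⟩

lemma coe_add' (a b : ℝ) : ((a + b : ℝ) : UnitAddCircle) = (a : UnitAddCircle) + (b : UnitAddCircle) := rfl
lemma coe_sub' (a b : ℝ) : ((a - b : ℝ) : UnitAddCircle) = (a : UnitAddCircle) - (b : UnitAddCircle) := rfl
lemma coe_neg' (a : ℝ) : ((-a : ℝ) : UnitAddCircle) = -(a : UnitAddCircle) := rfl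

lemma torusProj_surj (z : Torus2) : ∃ p : ℝ × ℝ, torusProj p = z := by
  obtain ⟨x, y⟩ := z
  obtain ⟨a, rfl⟩ := QuotientAddGroup.mk_surjective x
  obtain ⟨b, rfl⟩ := QuotientAddGroup.mk_surjective y
  exact ⟨(a, b), rfl⟩

/-- shear data: a smooth function of integer degree -/
structure ShearFn where
  a : ℝ → ℝ
  d : ℤ
  smooth : ContDiff ℝ (⊤ : ℕ∞) a
  deg : ∀ x (n : ℤ), a (x + n) = a x + d * n
  lip : ∃ C, LipschitzWith C a

namespace ShearFn

def neg (s : ShearFn) : ShearFn where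
  a := fun x => - s.a x
  d := - s.d
  smooth := s.smooth.neg
  deg := fun x n => by rw [s.deg]; push_cast; ring
  lip := by
    obtain ⟨C, hC⟩ := s.lip
    exact ⟨C, hC.neg⟩

lemma per (s : ShearFn) : Function.Periodic (fun x : ℝ => ((s.a x : ℝ) : UnitAddCircle)) 1 := by
  intro x
  have := s.deg x 1
  simp only [Int.cast_one, mul_one] at this
  simp only [this, coe_add', coe_int_zero, add_zero]

def bar (s : ShearFn) : UnitAddCircle → UnitAddCircle := s.per.lift

lemma bar_coe (s : ShearFn) (x : ℝ) : s.bar (x : UnitAddCircle) = (s.a x : UnitAddCircle) := rfl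

lemma neg_bar (s : ShearFn) (x : UnitAddCircle) : s.neg.bar x = - s.bar x := by
  obtain ⟨x, rfl⟩ := QuotientAddGroup.mk_surjective x
  rfl

lemma bar_lip (s : ShearFn) : ∃ C, LipschitzWith C s.bar := by
  obtain ⟨C, hC⟩ := s.lip
  refine ⟨C, LipschitzWith.of_dist_le_mul fun x y => ?_⟩
  obtain ⟨a, b, rfl, rfl, h⟩ := exists_real_rep x y
  rw [bar_coe, bar_coe, ← h]
  refine (dist_coe_le _ _).trans ?_
  have := hC.dist_le_mul a b
  simpa [Real.dist_eq] using this

def vshear (s : ShearFn) : LD where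
  e := { toFun := fun z => (z.1, z.2 + s.bar z.1)
         invFun := fun z => (z.1, z.2 + s.neg.bar z.1)
         left_inv := fun z => by simp [neg_bar]
         right_inv := fun z => by simp [neg_bar] }
  H := fun p => (p.1, p.2 + s.a p.1)
  Hi := fun p => (p.1, p.2 + s.neg.a p.1)
  M := fun m => (m.1, m.2 + s.d * m.1)
  Mi := fun m => (m.1, m.2 - s.d * m.1)
  hH := contDiff_fst.prodMk (contDiff_snd.add (s.smooth.comp contDiff_fst))
  hHi := contDiff_fst.prodMk (contDiff_snd.add (s.neg.smooth.comp contDiff_fst))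
  HM := fun p m => by
    ext
    · simp [zc]
    · simp only [zc, Prod.fst_add, Prod.snd_add, s.deg]; push_cast; ring
  HiM := fun p m => by
    ext
    · simp [zc]
    · simp only [zc, Prod.fst_add, Prod.snd_add, s.neg.deg]; simp only [neg]; push_cast; ring
  MMi := fun m => by ext <;> simp
  lift := fun p => rfl
  lifti := fun p => rfl
  mp := by
    obtain ⟨C, hC⟩ := s.bar_lip
    refine MeasurePreserving.skew_product (g := fun x y => y + s.bar x)
      (MeasurePreserving.id _) ?_ (Eventually.of_forall fun x => ?_)
    · have h1 : Measurable s.bar := hC.continuous.measurable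
      exact measurable_snd.add (h1.comp measurable_fst)
    · exact map_add_right_eq_self _ _
  lip := by
    obtain ⟨C, hC⟩ := s.bar_lip
    exact ⟨_, LipschitzWith.prodMk LipschitzWith.prod_fst
      (LipschitzWith.prod_snd.add (hC.comp LipschitzWith.prod_fst))⟩

def hshear (s : ShearFn) : LD := LD.swp.comp (s.vshear.comp LD.swp)

lemma vshear_H (s : ShearFn) (x y : ℝ) : s.vshear.H (x, y) = (x, y + s.a x) := rfl
lemma hshear_H (s : ShearFn) (x y : ℝ) : s.hshear.H (x, y) = (x + s.a y, y) := rfl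

end ShearFn

/-! ### Part 2: periodization and the basic building block -/

def perz (φ : ℝ → ℝ) (u : ℝ) : ℝ := φ (u - round u)

lemma perz_add_int (φ : ℝ → ℝ) (u : ℝ) (n : ℤ) : perz φ (u + n) = perz φ u := by
  unfold perz
  rw [round_add_intCast]; push_cast; congr 1; ring

lemma perz_contDiff {φ : ℝ → ℝ} (hφ : ContDiff ℝ (⊤ : ℕ∞) φ) {r : ℝ} (hr : r < 1/2)
    (h0 : ∀ u, r ≤ |u| → φ u = 0) : ContDiff ℝ (⊤ : ℕ∞) (perz φ) := by
  rw [contDiff_iff_contDiffAt]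
  intro u
  have hab := abs_sub_round u
  rcases lt_or_ge |u - round u| (1/2) with h | h
  · have : perz φ =ᶠ[𝓝 u] fun v => φ (v - round u) := by
      have hopen : IsOpen {v : ℝ | |v - round u| < 1/2} :=
        isOpen_lt (by fun_prop) continuous_const
      filter_upwards [hopen.mem_nhds h] with v hv
      have hv' : |v - round u| < 1/2 := hv
      have : round v = round u := by
        rw [abs_lt] at hv'
        rw [round_eq, Int.floor_eq_iff]
        constructor <;> linarith
      simp [perz, this]
    refine ContDiffAt.congr_of_eventuallyEq ?_ this
    exact (hφ.comp (contDiff_id.sub contDiff_const)).contDiffAt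
  · have : perz φ =ᶠ[𝓝 u] fun _ => 0 := by
      have hopen : IsOpen {v : ℝ | |v - u| < 1/2 - r} :=
        isOpen_lt (by fun_prop) continuous_const
      filter_upwards [hopen.mem_nhds (by simpa using hr)] with v hv
      have hv' : |v - u| < 1/2 - r := hv
      apply h0
      have h1 := round_le u (round v)
      have h2 : |u - round v| ≤ |u - v| + |v - round v| := abs_sub_le _ _ _
      rw [abs_sub_comm] at hv'
      linarith
    exact ContDiffAt.congr_of_eventuallyEq contDiffAt_const this

lemma perz_lip {φ : ℝ → ℝ} (hφ : ContDiff ℝ (⊤ : ℕ∞) φ) {r : ℝ} (hr : r < 1/2)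
    (h0 : ∀ u, r ≤ |u| → φ u = 0) : ∃ C, LipschitzWith C (perz φ) := by
  have hs := perz_contDiff hφ hr h0
  have hc : Continuous (deriv (perz φ)) := hs.continuous_deriv (by simp)
  have hper : ∀ u (n : ℤ), deriv (perz φ) (u + n) = deriv (perz φ) u := by
    intro u n
    have : (fun v => perz φ (v + n)) = perz φ := funext fun v => perz_add_int φ v n
    rw [← deriv_comp_add_const, this]
  obtain ⟨C, hC⟩ := isCompact_Icc.exists_bound_of_continuousOn (s := Set.Icc (0:ℝ) 1) hc.continuousOn
  have hb : ∀ u, ‖deriv (perz φ) u‖ ≤ C := by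
    intro u
    have := hper (Int.fract u) ⌊u⌋
    rw [Int.fract_add_floor] at this
    rw [this]
    exact hC _ ⟨Int.fract_nonneg u, (Int.fract_lt_one u).le⟩
  have hC0 : 0 ≤ C := (norm_nonneg _).trans (hb 0)
  exact ⟨⟨C, hC0⟩, lipschitzWith_of_nnnorm_deriv_le (hs.differentiable (by simp)) fun x => hb x⟩

/-- cut off identity: equals `v` for `|v| ≤ r`, vanishes for `|v| ≥ R`. -/
lemma exists_cut (r R : ℝ) (hr : 0 < r) (hR : r < R) :
    ∃ φ : ℝ → ℝ, ContDiff ℝ (⊤ : ℕ∞) φ ∧ (∀ v, |v| ≤ r → φ v = v) ∧ (∀ v, R ≤ |v| → φ v = 0) ∧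
      ∀ v, |φ v| ≤ R := by
  let b : ContDiffBump (0:ℝ) := ⟨r, R, hr, hR⟩
  have h0 : ∀ v, R ≤ |v| → v * b v = 0 := by
    intro v hv
    rw [b.zero_of_le_dist (by simpa using hv), mul_zero]
  refine ⟨fun v => v * b v, contDiff_id.mul b.contDiff, fun v hv => ?_, h0, fun v => ?_⟩
  · show v * b v = v
    rw [b.one_of_mem_closedBall (by simpa using hv), mul_one]
  · show |v * b v| ≤ R
    rcases le_total R |v| with h | h
    · rw [h0 v h]; simp; linarith
    · rw [abs_mul, abs_of_nonneg b.nonneg]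
      exact (mul_le_of_le_one_right (abs_nonneg v) b.le_one).trans h

structure Cut (r R : ℝ) where
  φ : ℝ → ℝ
  smooth : ContDiff ℝ (⊤ : ℕ∞) φ
  eq : ∀ v, |v| ≤ r → φ v = v
  zero : ∀ v, R ≤ |v| → φ v = 0
  bd : ∀ v, |φ v| ≤ R

def mkCut (r R : ℝ) (hr : 0 < r) (hR : r < R) : Cut r R := by
  have h := Classical.indefiniteDescription _ (exists_cut r R hr hR)
  exact ⟨h.1, h.2.1, h.2.2.1, h.2.2.2.1, h.2.2.2.2⟩

/-- shear function `c * perz φ (k x)` -/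
def Cut.shear {r R : ℝ} (φ : Cut r R) (hR : R < 1/2) (c : ℝ) (k : ℕ) : ShearFn where
  a := fun x => c * perz φ.φ (k * x)
  d := 0
  smooth := contDiff_const.mul ((perz_contDiff φ.smooth hR φ.zero).comp (contDiff_const.mul contDiff_id))
  deg := fun x n => by
    have : (k:ℝ) * (x + n) = k * x + ((k * n : ℤ) : ℝ) := by push_cast; ring
    rw [this, perz_add_int]; simp
  lip := by
    obtain ⟨C, hC⟩ := perz_lip φ.smooth hR φ.zero
    refine ⟨_, ((LipschitzWith.of_dist_le_mul (K := ‖c‖₊) (f := fun x => c * x) ?_).comp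
      (hC.comp (LipschitzWith.of_dist_le_mul (K := ‖(k:ℝ)‖₊) (f := fun x => (k:ℝ) * x) ?_)))⟩
    · intro x y; simp [Real.dist_eq, ← mul_sub, abs_mul]
    · intro x y; simp [Real.dist_eq, ← mul_sub, abs_mul]

def linShear (q : ℕ) : ShearFn where
  a := fun x => q * x
  d := q
  smooth := contDiff_const.mul contDiff_id
  deg := fun x n => by push_cast; ring
  lip := ⟨‖(q:ℝ)‖₊, LipschitzWith.of_dist_le_mul fun x y => by simp [Real.dist_eq, ← mul_sub, abs_mul]⟩

/-- parameters of a building block -/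
structure BP where
  q : ℕ
  ε : ℝ
  η : ℝ
  hq : 0 < q
  hε : 0 < ε
  hε' : ε < 1/4
  hη : 0 < η
  hη' : η < 1/2

namespace BP
variable (P : BP)

def cA : Cut (1/2 - P.η) (1/2 - P.η/2) :=
  mkCut _ _ (by linarith [P.hη']) (by linarith [P.hη])
def cB : Cut P.ε (2*P.ε) := mkCut _ _ P.hε (by linarith [P.hε])

def sA : ShearFn := P.cA.shear (by linarith [P.hη]) P.ε P.q
def sB : ShearFn := P.cB.shear (by linarith [P.hε']) (-(P.ε⁻¹ * (P.q:ℝ)⁻¹)) 1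

def g : LD :=
  P.sA.neg.vshear.comp (P.sB.neg.hshear.comp ((linShear P.q).vshear.comp
    (P.sB.hshear.comp P.sA.vshear)))

lemma g_H (x y : ℝ) : ∃ y1 x1 y2 x2, y1 = y + P.sA.a x ∧ x1 = x + P.sB.a y1 ∧ y2 = y1 + P.q * x1 ∧
    x2 = x1 - P.sB.a y2 ∧ P.g.H (x, y) = (x2, y2 - P.sA.a x2) :=
  ⟨_, _, _, _, rfl, rfl, rfl, rfl, rfl⟩

lemma sA_bd (x : ℝ) : |P.sA.a x| ≤ P.ε := by
  show |P.ε * perz P.cA.φ (P.q * x)| ≤ P.ε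
  rw [abs_mul, abs_of_pos P.hε]
  have := P.cA.bd (P.q * x - round (P.q * x))
  have h2 : |perz P.cA.φ (P.q * x)| ≤ 1 := this.trans (by linarith [P.hη])
  nlinarith [P.hε]

lemma sB_zero (y : ℝ) (hy : 2 * P.ε ≤ ‖(y : UnitAddCircle)‖) : P.sB.a y = 0 := by
  show -(P.ε⁻¹ * (P.q:ℝ)⁻¹) * perz P.cB.φ ((1:ℕ) * y) = 0
  rw [UnitAddCircle.norm_eq] at hy
  have : perz P.cB.φ ((1:ℕ) * y) = 0 := by
    simp only [Nat.cast_one, one_mul]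
    exact P.cB.zero _ hy
  rw [this, mul_zero]

lemma g_e (x y : ℝ) : P.g.e ((x : UnitAddCircle), (y : UnitAddCircle)) = torusProj (P.g.H (x, y)) :=
  (P.g.lift (x, y)).symm

lemma norm_coe_le (a : ℝ) : ‖(a : UnitAddCircle)‖ ≤ |a| := by
  simpa using dist_coe_le a 0

lemma norm_sub_A (y x : ℝ) : ‖(y : UnitAddCircle)‖ - P.ε ≤ ‖((y + P.sA.a x : ℝ) : UnitAddCircle)‖ := by
  have h1 := norm_coe_le (P.sA.a x)
  have h2 := P.sA_bd x
  have h3 := norm_sub_le ((y + P.sA.a x : ℝ) : UnitAddCircle) ((P.sA.a x : ℝ) : UnitAddCircle)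
  rw [← coe_sub', add_sub_cancel_right] at h3
  linarith

lemma norm_add_A (y x : ℝ) : ‖((y + P.sA.a x : ℝ) : UnitAddCircle)‖ ≤ ‖(y : UnitAddCircle)‖ + P.ε := by
  have h1 := norm_coe_le (P.sA.a x)
  have h2 := P.sA_bd x
  have h3 := norm_add_le (y : UnitAddCircle) ((P.sA.a x : ℝ) : UnitAddCircle)
  rw [← coe_add'] at h3
  linarith

lemma norm_sub_A' (y x : ℝ) : ‖((y - P.sA.a x : ℝ) : UnitAddCircle)‖ ≤ ‖(y : UnitAddCircle)‖ + P.ε := by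
  have h1 := norm_coe_le (P.sA.a x)
  have h2 := P.sA_bd x
  have h3 := norm_sub_le (y : UnitAddCircle) ((P.sA.a x : ℝ) : UnitAddCircle)
  rw [← coe_sub'] at h3
  linarith

lemma coe_nat_mul (q : ℕ) (x : ℝ) : ((q * x : ℝ) : UnitAddCircle) = q • (x : UnitAddCircle) := by
  rw [← nsmul_eq_mul]; rfl

/-- outside the strip -/
lemma g_out (z : Torus2) (hz : 3 * P.ε ≤ ‖z.2‖) :
    (3 * P.ε ≤ ‖z.2 + P.q • z.1‖ → (P.g.e z).2 = z.2 + P.q • z.1) ∧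
    (‖z.2 + P.q • z.1‖ < 3 * P.ε → ‖(P.g.e z).2‖ < 5 * P.ε) := by
  obtain ⟨⟨x, y⟩, rfl⟩ := torusProj_surj z
  change 3 * P.ε ≤ ‖(y : UnitAddCircle)‖ at hz
  have hε := P.hε
  show (3 * P.ε ≤ ‖(y : UnitAddCircle) + P.q • (x : UnitAddCircle)‖ →
    (P.g.e ((x : UnitAddCircle), (y : UnitAddCircle))).2 = (y : UnitAddCircle) + P.q • (x : UnitAddCircle)) ∧
    (‖(y : UnitAddCircle) + P.q • (x : UnitAddCircle)‖ < 3 * P.ε →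
      ‖(P.g.e ((x : UnitAddCircle), (y : UnitAddCircle))).2‖ < 5 * P.ε)
  rw [g_e, ← coe_nat_mul, ← coe_add']
  obtain ⟨y1, x1, y2, x2, h1, h2, h3, h4, h5⟩ := P.g_H x y
  have e1 : P.sB.a y1 = 0 := P.sB_zero _ (by rw [h1]; linarith [P.norm_sub_A y x])
  rw [e1, add_zero] at h2
  subst h2
  have h3' : y2 = (y + P.q * x1) + P.sA.a x1 := by rw [h3, h1]; ring
  rw [h5]
  show (_ → (((y2 - P.sA.a x2 : ℝ)) : UnitAddCircle) = _) ∧ (_ → ‖(((y2 - P.sA.a x2 : ℝ)) : UnitAddCircle)‖ < _)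
  constructor
  · intro h
    have e2 : P.sB.a y2 = 0 := P.sB_zero _ (by rw [h3']; linarith [P.norm_sub_A (y + P.q * x1) x1])
    rw [e2, sub_zero] at h4
    rw [h4, h3', add_sub_cancel_right]
  · intro h
    have := P.norm_sub_A' y2 x2
    have h6 := P.norm_add_A (y + P.q * x1) x1
    rw [← h3'] at h6
    linarith

lemma g_strip (z : Torus2) (s : ℝ) (hz : ‖z.2‖ ≤ s) :
    ‖(P.g.e z).2 - P.q • (P.g.e z).1‖ ≤ s + 2 * P.ε ∨ ‖(P.g.e z).2‖ ≤ 3 * P.ε := by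
  obtain ⟨⟨x, y⟩, rfl⟩ := torusProj_surj z
  change ‖(y : UnitAddCircle)‖ ≤ s at hz
  have hε := P.hε
  show ‖(P.g.e ((x : UnitAddCircle), (y : UnitAddCircle))).2 - P.q • (P.g.e ((x : UnitAddCircle), (y : UnitAddCircle))).1‖ ≤ s + 2 * P.ε
    ∨ ‖(P.g.e ((x : UnitAddCircle), (y : UnitAddCircle))).2‖ ≤ 3 * P.ε
  rw [g_e]
  obtain ⟨y1, x1, y2, x2, h1, h2, h3, h4, h5⟩ := P.g_H x y
  rw [h5]
  show ‖(((y2 - P.sA.a x2 : ℝ)) : UnitAddCircle) - P.q • (x2 : UnitAddCircle)‖ ≤ _ ∨ ‖(((y2 - P.sA.a x2 : ℝ)) : UnitAddCircle)‖ ≤ _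
  rcases le_or_gt (2 * P.ε) ‖(y2 : UnitAddCircle)‖ with h | h
  · left
    have e2 : P.sB.a y2 = 0 := P.sB_zero _ h
    rw [e2, sub_zero] at h4
    subst h4
    rw [← coe_nat_mul, ← coe_sub']
    have : y2 - P.sA.a x2 - P.q * x2 = y1 - P.sA.a x2 := by rw [h3]; ring
    rw [this]
    have a1 := P.norm_sub_A' y1 x2
    have a2 := P.norm_add_A y x
    rw [← h1] at a2
    linarith
  · right
    have a1 := P.norm_sub_A' y2 x2
    linarith

lemma sA_shift (x : ℝ) (j : ℤ) : P.sA.a (x + j / P.q) = P.sA.a x := by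
  show P.ε * perz P.cA.φ (P.q * (x + j / P.q)) = P.ε * perz P.cA.φ (P.q * x)
  have hq : (P.q : ℝ) ≠ 0 := by exact_mod_cast P.hq.ne'
  have : (P.q : ℝ) * (x + j / P.q) = P.q * x + j := by field_simp
  rw [this, perz_add_int]

lemma sB_shift (x : ℝ) (j : ℤ) : P.sB.a (x + j) = P.sB.a x := by
  rw [P.sB.deg]; simp [sB, Cut.shear]

end BP

/-- horizontal translation -/
def Rt (t : ℝ) (z : Torus2) : Torus2 := (z.1 + (t : UnitAddCircle), z.2)

namespace BP
variable (P : BP)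

lemma g_comm (j : ℤ) (z : Torus2) : P.g.e (Rt (j / P.q) z) = Rt (j / P.q) (P.g.e z) := by
  obtain ⟨⟨x, y⟩, rfl⟩ := torusProj_surj z
  have hq : (P.q : ℝ) ≠ 0 := by exact_mod_cast P.hq.ne'
  show P.g.e (((x + j / P.q : ℝ) : UnitAddCircle), (y : UnitAddCircle)) = Rt (j / P.q) (P.g.e ((x : UnitAddCircle), (y : UnitAddCircle)))
  rw [g_e, g_e]
  obtain ⟨y1, x1, y2, x2, h1, h2, h3, h4, h5⟩ := P.g_H x y
  obtain ⟨y1', x1', y2', x2', h1', h2', h3', h4', h5'⟩ := P.g_H (x + j / P.q) y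
  rw [h5, h5']
  have a1 : y1' = y1 := by rw [h1', h1, sA_shift]
  have a2 : x1' = x1 + j / P.q := by rw [h2', h2, a1]; ring
  have a3 : y2' = y2 + j := by rw [h3', h3, a1, a2]; field_simp; ring
  have a4 : x2' = x2 + j / P.q := by rw [h4', h4, a3, sB_shift, a2]; ring
  rw [a3, a4, sA_shift]
  have : y2 + j - P.sA.a x2 = (y2 - P.sA.a x2) + j := by ring
  rw [this]
  refine Prod.ext rfl ?_
  show ((y2 - P.sA.a x2 + j : ℝ) : UnitAddCircle) = ((y2 - P.sA.a x2 : ℝ) : UnitAddCircle)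
  rw [coe_add', coe_int_zero, add_zero]

lemma g_fix (x : UnitAddCircle) (hx : P.η ≤ ‖P.q • x - ((1/2 : ℝ) : UnitAddCircle)‖) :
    P.g.e (x, 0) = (x, 0) := by
  obtain ⟨x, rfl⟩ := QuotientAddGroup.mk_surjective x
  change P.η ≤ ‖P.q • (x : UnitAddCircle) - ((1/2 : ℝ) : UnitAddCircle)‖ at hx
  show P.g.e ((x : UnitAddCircle), ((0:ℝ) : UnitAddCircle)) = ((x : UnitAddCircle), 0)
  have hε := P.hε
  have hε' := P.hε'
  have hη := P.hη
  have hq : (P.q : ℝ) ≠ 0 := by exact_mod_cast P.hq.ne'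
  set v := P.q * x - round (P.q * x) with hv
  have hvb : |v| ≤ 1/2 := abs_sub_round _
  have hv2 : |v| ≤ 1/2 - P.η := by
    rw [← coe_nat_mul, ← coe_sub'] at hx
    have k1 : (P.q * x - 1/2 : ℝ) = (v - 1/2) + round (P.q * x) := by rw [hv]; ring
    have k2 : (P.q * x - 1/2 : ℝ) = (v + 1/2) + ((round (P.q * x) - 1 : ℤ) : ℝ) := by rw [hv]; push_cast; ring
    have m1 : P.η ≤ |v - 1/2| := by
      rw [k1, coe_add', coe_int_zero, add_zero] at hx
      exact hx.trans (norm_coe_le _)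
    have m2 : P.η ≤ |v + 1/2| := by
      rw [k2, coe_add', coe_int_zero, add_zero] at hx
      exact hx.trans (norm_coe_le _)
    rw [abs_le] at hvb
    rw [abs_of_nonpos (by linarith)] at m1
    rw [abs_of_nonneg (by linarith)] at m2
    rw [abs_le]; constructor <;> linarith
  have hA : P.sA.a x = P.ε * v := by
    show P.ε * perz P.cA.φ (P.q * x) = _
    unfold perz
    rw [P.cA.eq _ hv2]
  have hB : P.sB.a (P.ε * v) = - v / P.q := by
    show -(P.ε⁻¹ * (P.q:ℝ)⁻¹) * perz P.cB.φ ((1:ℕ) * (P.ε * v)) = _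
    have hsm : |P.ε * v| ≤ P.ε / 2 := by rw [abs_mul, abs_of_pos hε]; nlinarith
    have hr : round (P.ε * v) = 0 := by
      rw [abs_le] at hsm
      rw [round_eq, Int.floor_eq_iff]; constructor <;> push_cast <;> linarith
    unfold perz
    simp only [Nat.cast_one, one_mul, hr, Int.cast_zero, sub_zero]
    rw [P.cB.eq _ (by linarith)]
    field_simp
  rw [g_e]
  obtain ⟨y1, x1, y2, x2, h1, h2, h3, h4, h5⟩ := P.g_H x 0
  rw [h5]
  have a1 : y1 = P.ε * v := by rw [h1, hA, zero_add]
  have a2 : x1 = x - v / P.q := by rw [h2, a1, hB]; ring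
  have a3 : y2 = P.ε * v + round (P.q * x) := by rw [h3, a1, a2, hv]; field_simp; ring
  have a4 : x2 = x := by rw [h4, a3, sB_shift, hB, a2]; ring
  rw [a4, a3, hA, add_sub_cancel_left]
  refine Prod.ext rfl ?_
  exact coe_int_zero _

end BP

/-! ### Part 3: smooth closeness of conjugated translations -/

namespace LD

/-- lift of `h R_t h⁻¹` -/
def Phi (h : LD) (t : ℝ) (p : ℝ × ℝ) : ℝ × ℝ := h.H (h.Hi p + (t, 0))

lemma Phi_contDiff (h : LD) : ContDiff ℝ (⊤ : ℕ∞) (fun u : ℝ × (ℝ × ℝ) => h.Phi u.1 u.2) := by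
  refine h.hH.comp ((h.hHi.comp contDiff_snd).add (contDiff_fst.prodMk contDiff_const))

lemma Phi_per (h : LD) (t : ℝ) (p : ℝ × ℝ) (m : ℤ × ℤ) : h.Phi t (p + zc m) = h.Phi t p + zc m := by
  unfold Phi
  rw [h.HiM, add_right_comm, h.HM, h.MMi]

/-- `h R_t h⁻¹` on the torus -/
def conj (h : LD) (t : ℝ) (z : Torus2) : Torus2 := h.e (Rt t (h.e.symm z))

lemma Phi_lift (h : LD) (t : ℝ) : IsLift (h.Phi t) (h.conj t) := by
  intro p
  unfold Phi conj
  rw [h.lift, ← h.lifti]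
  congr 1
  refine Prod.ext rfl ?_
  show (((h.Hi p).2 + 0 : ℝ) : UnitAddCircle) = _
  rw [add_zero]; rfl

/-- difference map -/
def Del (h : LD) (a t : ℝ) (p : ℝ × ℝ) : ℝ × ℝ := h.Phi t p - h.Phi a p

lemma Del_contDiff (h : LD) (a t : ℝ) : ContDiff ℝ (⊤ : ℕ∞) (h.Del a t) := by
  have h1 := h.Phi_contDiff.comp (contDiff_const.prodMk contDiff_id : ContDiff ℝ (⊤ : ℕ∞) fun p : ℝ × ℝ => (t, p))
  have h2 := h.Phi_contDiff.comp (contDiff_const.prodMk contDiff_id : ContDiff ℝ (⊤ : ℕ∞) fun p : ℝ × ℝ => (a, p))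
  exact h1.sub h2

lemma Del_per (h : LD) (a t : ℝ) (p : ℝ × ℝ) (m : ℤ × ℤ) : h.Del a t (p + zc m) = h.Del a t p := by
  unfold Del
  rw [Phi_per, Phi_per]; abel

lemma Del_close_one (h : LD) (a δ : ℝ) (hδ : 0 < δ) (k : ℕ) :
    ∀ᶠ t in 𝓝 a, ∀ p, ‖iteratedFDeriv ℝ k (h.Del a t) p‖ ≤ δ := by
  let G : ℝ × (ℝ × ℝ) → ℝ × ℝ := fun u => h.Phi u.1 u.2 - h.Phi a u.2
  have hG : ContDiff ℝ (⊤ : ℕ∞) G := h.Phi_contDiff.sub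
    (h.Phi_contDiff.comp (contDiff_const.prodMk contDiff_snd : ContDiff ℝ (⊤ : ℕ∞) fun u : ℝ × (ℝ × ℝ) => (a, u.2)))
  have key : ∀ t p, iteratedFDeriv ℝ k (h.Del a t) p =
      (iteratedFDeriv ℝ k G (t, p)).compContinuousLinearMap
        (fun _ => ContinuousLinearMap.inr ℝ ℝ (ℝ × ℝ)) := by
    intro t p
    have e1 : h.Del a t = (fun u => G (u + (t, 0))) ∘ (ContinuousLinearMap.inr ℝ ℝ (ℝ × ℝ)) := by
      funext p
      simp [G, Del]
    have hG2 : ContDiff ℝ (⊤ : ℕ∞) (fun u => G (u + (t, 0))) := hG.comp (contDiff_id.add contDiff_const)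
    rw [e1, ContinuousLinearMap.iteratedFDeriv_comp_right (n := (⊤ : ℕ∞)) _ hG2 p (by exact_mod_cast le_top)]
    rw [iteratedFDeriv_comp_add_right]
    simp
  have hcont : Continuous (fun u : ℝ × (ℝ × ℝ) => ‖iteratedFDeriv ℝ k (h.Del a u.1) u.2‖) := by
    simp_rw [key]
    have h1 : Continuous (iteratedFDeriv ℝ k G) := hG.continuous_iteratedFDeriv (by exact_mod_cast le_top)
    have h2 := (ContinuousMultilinearMap.compContinuousLinearMapL (𝕜 := ℝ) (F := ℝ × ℝ)
      (fun _ : Fin k => ContinuousLinearMap.inr ℝ ℝ (ℝ × ℝ))).continuous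
    exact (h2.comp h1).norm
  have hper : ∀ t p m, iteratedFDeriv ℝ k (h.Del a t) (p + zc m) = iteratedFDeriv ℝ k (h.Del a t) p := by
    intro t p m
    rw [← iteratedFDeriv_comp_add_right]
    simp_rw [Del_per]
  have hzero : ∀ p, ‖iteratedFDeriv ℝ k (h.Del a a) p‖ = 0 := by
    intro p
    have : h.Del a a = fun _ => 0 := by funext p; simp [Del]
    rw [this]
    simp
  have hK : IsCompact (Set.Icc (0:ℝ) 1 ×ˢ Set.Icc (0:ℝ) 1) := isCompact_Icc.prod isCompact_Icc
  have hop : IsOpen {u : ℝ × (ℝ × ℝ) | ‖iteratedFDeriv ℝ k (h.Del a u.1) u.2‖ < δ} :=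
    isOpen_lt hcont continuous_const
  obtain ⟨U, V, hU, -, haU, hKV, hUV⟩ := generalized_tube_lemma (s := {a}) isCompact_singleton hK hop (by
    rintro ⟨t, p⟩ ⟨ht, -⟩
    have ht' : t = a := ht
    subst ht'
    show ‖_‖ < δ
    rw [hzero]; exact hδ)
  filter_upwards [hU.mem_nhds (haU rfl)] with t ht p
  have := hper t (Int.fract p.1, Int.fract p.2) (⌊p.1⌋, ⌊p.2⌋)
  have e : (Int.fract p.1, Int.fract p.2) + zc (⌊p.1⌋, ⌊p.2⌋) = p := by
    ext <;> simp [zc]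
  rw [e] at this
  rw [this]
  have hm : (t, (Int.fract p.1, Int.fract p.2)) ∈ U ×ˢ V := ⟨ht, hKV ⟨
    ⟨Int.fract_nonneg _, (Int.fract_lt_one _).le⟩, ⟨Int.fract_nonneg _, (Int.fract_lt_one _).le⟩⟩⟩
  exact (hUV hm).le

lemma Del_close (h : LD) (a δ : ℝ) (hδ : 0 < δ) (N : ℕ) :
    ∀ᶠ t in 𝓝 a, ∀ k ≤ N, ∀ p, ‖iteratedFDeriv ℝ k (h.Del a t) p‖ ≤ δ := by
  have := (Finset.range (N+1)).eventually_all.2 (fun k _ => h.Del_close_one a δ hδ k)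
  filter_upwards [this] with t ht k hk
  exact ht k (by simp; omega)

end LD

/-! ### Part 4: averaging lemmas -/

lemma Rt_add (s t : ℝ) (z : Torus2) : Rt s (Rt t z) = Rt (s + t) z := by
  unfold Rt
  rw [coe_add', add_assoc, add_comm (t : UnitAddCircle)]

lemma Rt_int (s : ℝ) (n : ℤ) (z : Torus2) : Rt (s + n) z = Rt s z := by
  unfold Rt
  rw [coe_add', coe_int_zero, add_zero]

lemma perm_sum (p : ℤ) (q : ℕ) (hq : 0 < q) (hpq : IsCoprime p (q : ℤ)) (φ : UnitAddCircle → ℝ) (i : ℤ) :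
    ∑ j ∈ Finset.range q, φ (((i + j) * (p / q) : ℝ) : UnitAddCircle) =
      ∑ j ∈ Finset.range q, φ ((j / q : ℝ) : UnitAddCircle) := by
  have hq0 : (q : ℝ) ≠ 0 := by exact_mod_cast hq.ne'
  have hqz : (0 : ℤ) < q := by exact_mod_cast hq
  let σ : ℕ → ℕ := fun j => (((i + j) * p) % (q : ℤ)).toNat
  have hσ : ∀ j, ((σ j : ℕ) : ℤ) = ((i + j) * p) % (q : ℤ) := fun j =>
    Int.toNat_of_nonneg (Int.emod_nonneg _ hqz.ne')
  have hinj : Set.InjOn σ (Finset.range q : Set ℕ) := by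
    intro a ha b hb hab
    have h1 : ((σ a : ℕ) : ℤ) = σ b := by rw [hab]
    rw [hσ, hσ] at h1
    have h2 : (q : ℤ) ∣ ((i + a) * p - (i + b) * p) := 
      Int.ModEq.dvd (show (i + b) * p ≡ (i + a) * p [ZMOD q] from h1.symm)
    have h3 : (q : ℤ) ∣ ((a : ℤ) - b) * p := by convert h2 using 1; ring
    have h4 : (q : ℤ) ∣ ((a : ℤ) - b) := hpq.symm.dvd_of_dvd_mul_right h3
    have ha' : a < q := by simpa using ha
    have hb' : b < q := by simpa using hb
    have h5 := Int.eq_zero_of_abs_lt_dvd h4 (by rw [abs_lt]; constructor <;> omega)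
    omega
  have himg : (Finset.range q).image σ = Finset.range q := by
    apply Finset.eq_of_subset_of_card_le
    · intro k hk
      obtain ⟨j, -, rfl⟩ := Finset.mem_image.1 hk
      have := Int.emod_lt_of_pos ((i + j) * p) hqz
      rw [← hσ] at this
      simpa using this
    · rw [Finset.card_image_of_injOn hinj]
  have hre : ∑ j ∈ Finset.range q, φ ((j / q : ℝ) : UnitAddCircle) =
      ∑ j ∈ Finset.range q, φ ((σ j / q : ℝ) : UnitAddCircle) := by
    conv_lhs => rw [← himg]
    rw [Finset.sum_image hinj]
  rw [hre]
  refine Finset.sum_congr rfl fun j _ => ?_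
  congr 1
  have h := Int.emod_add_mul_ediv ((i + j) * p) q
  rw [← hσ] at h
  have h' : ((σ j : ℕ) : ℝ) + q * (((i + j) * p / (q : ℤ) : ℤ) : ℝ) = (i + j) * p := by exact_mod_cast h
  have : ((i + j) * (p / q) : ℝ) = (σ j : ℝ) / q + (((i + j) * p / (q : ℤ) : ℤ) : ℝ) := by
    field_simp
    linarith
  rw [this, coe_add', coe_int_zero, add_zero]

lemma riemann_sum (q : ℕ) (hq : 0 < q) (φ : UnitAddCircle → ℝ) (L : NNReal) (hL : LipschitzWith L φ) :
    |∑ j ∈ Finset.range q, φ ((j / q : ℝ) : UnitAddCircle) - q * ∫ x, φ x| ≤ L := by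
  have hq0 : (0:ℝ) < q := by exact_mod_cast hq
  have hc : Continuous fun t : ℝ => φ (t : UnitAddCircle) := hL.continuous.comp (AddCircle.continuous_mk' _)
  have h1 : ∫ x, φ x = ∑ j ∈ Finset.range q, ∫ t in ((j:ℝ)/q)..(((j+1 : ℕ):ℝ)/q), φ (t : UnitAddCircle) := by
    rw [intervalIntegral.sum_integral_adjacent_intervals (a := fun j : ℕ => (j:ℝ)/q)
      (fun k _ => hc.intervalIntegrable _ _)]
    rw [← UnitAddCircle.intervalIntegral_preimage 0]
    simp [hq0.ne']
  have h2 : ∀ j : ℕ, |(φ ((j / q : ℝ) : UnitAddCircle)) / q - ∫ t in ((j:ℝ)/q)..(((j+1 : ℕ):ℝ)/q), φ (t : UnitAddCircle)| ≤ L / q / q := by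
    intro j
    have e : ((j+1 : ℕ):ℝ)/q - (j:ℝ)/q = 1/q := by push_cast; ring
    have e1 : (φ ((j / q : ℝ) : UnitAddCircle)) / q = ∫ t in ((j:ℝ)/q)..(((j+1 : ℕ):ℝ)/q), φ ((j / q : ℝ) : UnitAddCircle) := by
      rw [intervalIntegral.integral_const, e, smul_eq_mul]; ring
    rw [e1, ← intervalIntegral.integral_sub (by simp) (hc.intervalIntegrable _ _)]
    have := intervalIntegral.norm_integral_le_of_norm_le_const (a := ((j:ℝ)/q)) (b := (((j+1 : ℕ):ℝ)/q))
      (C := L / q) (f := fun t => φ ((j / q : ℝ) : UnitAddCircle) - φ (t : UnitAddCircle)) ?_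
    · rw [e, abs_of_pos (by positivity)] at this
      rw [← Real.norm_eq_abs]
      refine this.trans (le_of_eq ?_); ring
    · intro t ht
      rw [Set.uIoc_of_le (by linarith [show (0:ℝ) < 1/q by positivity])] at ht
      have h3 := hL.dist_le_mul ((j / q : ℝ) : UnitAddCircle) (t : UnitAddCircle)
      have h4 := dist_coe_le (j / q : ℝ) t
      rw [← Real.dist_eq] at h4
      rw [← dist_eq_norm]
      have h5 : dist (j / q : ℝ) t ≤ 1 / q := by
        rw [Real.dist_eq, abs_le]; constructor <;> linarith [ht.1, ht.2]
      calc _ ≤ _ := h3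
        _ ≤ L * (1 / q) := by gcongr; exact h4.trans h5
        _ = _ := by ring
  have h3 : ∑ j ∈ Finset.range q, φ ((j / q : ℝ) : UnitAddCircle) - q * ∫ x, φ x =
      q * ∑ j ∈ Finset.range q, ((φ ((j / q : ℝ) : UnitAddCircle)) / q - ∫ t in ((j:ℝ)/q)..(((j+1 : ℕ):ℝ)/q), φ (t : UnitAddCircle)) := by
    rw [Finset.sum_sub_distrib, ← h1, mul_sub, ← Finset.sum_div]
    field_simp
  rw [h3, abs_mul, abs_of_pos hq0]
  calc q * |_| ≤ q * ∑ j ∈ Finset.range q, (L / q / q : ℝ) := by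
        gcongr
        exact (Finset.abs_sum_le_sum_abs _ _).trans (Finset.sum_le_sum fun j _ => h2 j)
    _ = L := by rw [Finset.sum_const, Finset.card_range, nsmul_eq_mul]; field_simp

lemma window_sum (Φ : ℕ → ℝ) (hΦ : ∀ i, |Φ i| ≤ 1) (q N : ℕ) :
    |q * ∑ i ∈ Finset.range N, Φ i - ∑ i ∈ Finset.range N, ∑ j ∈ Finset.range q, Φ (i + j)| ≤ q * (2 * q) := by
  have h1 : ∀ j, |∑ i ∈ Finset.range N, Φ i - ∑ i ∈ Finset.range N, Φ (i + j)| ≤ 2 * j := by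
    intro j
    induction j with
    | zero => simp
    | succ j ih =>
      have e : ∑ i ∈ Finset.range N, Φ (i + (j+1)) - ∑ i ∈ Finset.range N, Φ (i + j) = Φ (N + j) - Φ (0 + j) := by
        rw [← Finset.sum_range_sub (fun i => Φ (i + j)), Finset.sum_sub_distrib]
        congr 1
        refine Finset.sum_congr rfl fun i _ => ?_
        congr 1; omega
      have a1 := abs_le.1 (hΦ (N + j))
      have a2 := abs_le.1 (hΦ (0 + j))
      rw [abs_le] at ih ⊢
      push_cast
      constructor <;> linarith [ih.1, ih.2]
  rw [Finset.sum_comm]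
  have : (q:ℝ) * ∑ i ∈ Finset.range N, Φ i = ∑ j ∈ Finset.range q, ∑ i ∈ Finset.range N, Φ i := by
    rw [Finset.sum_const, Finset.card_range, nsmul_eq_mul]
  rw [this, ← Finset.sum_sub_distrib]
  refine (Finset.abs_sum_le_sum_abs _ _).trans ?_
  calc _ ≤ ∑ j ∈ Finset.range q, (2 * q : ℝ) := Finset.sum_le_sum fun j hj => (h1 j).trans (by
        have : j < q := by simpa using hj
        have : (j:ℝ) ≤ q := by exact_mod_cast this.le
        linarith)
    _ = _ := by rw [Finset.sum_const, Finset.card_range, nsmul_eq_mul]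

lemma norm_lt_iff_exists (u s : ℝ) (h : ‖(u : UnitAddCircle)‖ < s) : ∃ k : ℤ, |u - k| < s := by
  rw [UnitAddCircle.norm_eq] at h
  exact ⟨_, h⟩

lemma le_of_norm (u s : ℝ) (h : s ≤ ‖(u : UnitAddCircle)‖) (k : ℤ) : s ≤ |u - k| := by
  have := BP.norm_coe_le (u - k)
  rw [coe_sub', coe_int_zero, sub_zero] at this
  linarith

lemma card_Icc_le (a b : ℝ) (hab : a ≤ b) : ((Finset.Icc ⌈a⌉ ⌊b⌋).card : ℝ) ≤ b - a + 1 := by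
  rw [Int.card_Icc]
  have h1 := Int.floor_le b
  have h2 := Int.le_ceil a
  rcases le_total 0 (⌊b⌋ + 1 - ⌈a⌉) with h | h
  · have : (((⌊b⌋ + 1 - ⌈a⌉).toNat : ℤ) : ℝ) = ((⌊b⌋ + 1 - ⌈a⌉ : ℤ) : ℝ) := by rw [Int.toNat_of_nonneg h]
    rw [Int.cast_natCast] at this
    rw [this]; push_cast; linarith
  · rw [Int.toNat_of_nonpos h]; push_cast; linarith

open Classical in
lemma count_strip (v τ s sp : ℝ) (N : ℕ) (hτ : 0 < τ) (hs : 0 < s) (hsp : s < sp) (hsp2 : sp ≤ 1/2)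
    (hv : sp ≤ ‖(v : UnitAddCircle)‖) :
    (((Finset.range N).filter fun i : ℕ => ‖((v + i * τ : ℝ) : UnitAddCircle)‖ < s).card : ℝ) * (sp - s)
      ≤ N * (2 * s + τ) := by
  set B := (Finset.range N).filter fun i : ℕ => ‖((v + i * τ : ℝ) : UnitAddCircle)‖ < s with hB
  rcases B.eq_empty_or_nonempty with h0 | ⟨i0, hi0⟩
  · rw [h0]; simp; positivity
  have hk : ∀ i : ℕ, ∃ k : ℤ, i ∈ B → |v + i * τ - k| < s := by
    intro i
    by_cases hi : i ∈ B
    · obtain ⟨k, hk⟩ := norm_lt_iff_exists _ _ (Finset.mem_filter.1 hi).2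
      exact ⟨k, fun _ => hk⟩
    · exact ⟨0, fun h => (hi h).elim⟩
  choose K hK using hk
  let a := v + sp
  let b := v + (N - 1) * τ + s
  have hKI : ∀ i ∈ B, a ≤ K i ∧ (K i : ℝ) ≤ b := by
    intro i hi
    have h1 := abs_lt.1 (hK i hi)
    have hiN : i < N := by simpa using (Finset.mem_filter.1 hi).1
    have hiN' : (i:ℝ) ≤ N - 1 := by
      have : (i:ℝ) + 1 ≤ N := by exact_mod_cast hiN
      linarith
    have h2 : (i:ℝ) * τ ≤ (N - 1) * τ := by gcongr
    have h3 : 0 ≤ (i:ℝ) * τ := by positivity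
    have h4 := le_of_norm v sp hv (K i)
    constructor
    · show v + sp ≤ K i
      rcases le_abs.1 h4 with h | h <;> linarith
    · show (K i : ℝ) ≤ v + (N - 1) * τ + s
      linarith
  have hab : a ≤ b := (hKI i0 hi0).1.trans (hKI i0 hi0).2
  have hcard1 := card_Icc_le a b hab
  have hmaps : ∀ i ∈ B, K i ∈ Finset.Icc ⌈a⌉ ⌊b⌋ := by
    intro i hi
    rw [Finset.mem_Icc]
    exact ⟨Int.ceil_le.2 (hKI i hi).1, Int.le_floor.2 (hKI i hi).2⟩
  have hfib : ∀ k ∈ Finset.Icc ⌈a⌉ ⌊b⌋, (B.filter fun i => K i = k).card ≤ ⌊2 * s / τ + 1⌋₊ := by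
    intro k _
    apply Nat.le_floor
    have h1 := card_Icc_le ((k - s - v) / τ) ((k + s - v) / τ) (by gcongr; linarith)
    have e : (k + s - v) / τ - (k - s - v) / τ + 1 = 2 * s / τ + 1 := by field_simp; ring
    rw [e] at h1
    refine le_trans ?_ h1
    have : ((B.filter fun i => K i = k).card) ≤ (Finset.Icc ⌈(k - s - v) / τ⌉ ⌊(k + s - v) / τ⌋).card := by
      apply Finset.card_le_card_of_injOn (fun i : ℕ => (i : ℤ))
      · intro i hi
        obtain ⟨hi1, hi2⟩ := Finset.mem_filter.1 hi
        have h2 := abs_lt.1 (hK i hi1)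
        rw [hi2] at h2
        simp only [Finset.coe_Icc, Set.mem_Icc]
        constructor
        · rw [Int.ceil_le, div_le_iff₀ hτ]; push_cast; linarith
        · rw [Int.le_floor, le_div_iff₀ hτ]; push_cast; linarith
      · intro i _ j _ hij
        simpa using hij
    exact_mod_cast this
  have hmain := Finset.card_le_mul_card_image_of_maps_to hmaps _ hfib
  have hmain' : (B.card : ℝ) ≤ (⌊2 * s / τ + 1⌋₊ : ℝ) * ((Finset.Icc ⌈a⌉ ⌊b⌋).card : ℝ) := by exact_mod_cast hmain
  have hfl : (⌊2 * s / τ + 1⌋₊ : ℝ) ≤ 2 * s / τ + 1 := Nat.floor_le (by positivity)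
  have hc : 0 < sp - s := by linarith
  have hba : b - a + 1 = (N - 1) * τ - (sp - s) + 1 := by show v + (N - 1) * τ + s - (v + sp) + 1 = _; ring
  have hba0 : 0 ≤ (N - 1) * τ - (sp - s) := by linarith
  have h6 : ((Finset.Icc ⌈a⌉ ⌊b⌋).card : ℝ) * (sp - s) ≤ N * τ := by
    rw [hba] at hcard1
    calc _ ≤ ((N - 1) * τ - (sp - s) + 1) * (sp - s) := by gcongr
      _ ≤ ((N - 1) * τ - (sp - s)) * 1 + (sp - s) := by nlinarith
      _ ≤ N * τ := by linarith
  calc (B.card : ℝ) * (sp - s) ≤ ((2 * s / τ + 1) * ((Finset.Icc ⌈a⌉ ⌊b⌋).card : ℝ)) * (sp - s) := by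
        gcongr; exact hmain'.trans (by gcongr)
    _ = (2 * s / τ + 1) * (((Finset.Icc ⌈a⌉ ⌊b⌋).card : ℝ) * (sp - s)) := by ring
    _ ≤ (2 * s / τ + 1) * (N * τ) := by gcongr
    _ = N * (2 * s + τ) := by field_simp

/-! ### Part 5: orbit averages -/

instance instProbCircle : IsProbabilityMeasure (volume : Measure UnitAddCircle) := ⟨UnitAddCircle.measure_univ⟩

instance instProbTorus : IsProbabilityMeasure (volume : Measure Torus2) :=
  inferInstanceAs (IsProbabilityMeasure ((volume : Measure UnitAddCircle).prod (volume : Measure UnitAddCircle)))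

def Psi (h : LD) (f : Torus2 → ℝ) (y : UnitAddCircle) : ℝ := ∫ x, f (h.e (x, y))

lemma LD.cont (h : LD) : Continuous h.e := by
  obtain ⟨K, hK⟩ := h.lip
  exact hK.continuous

lemma integrable_of_cont {X : Type*} [TopologicalSpace X] [CompactSpace X] [MeasurableSpace X] [OpensMeasurableSpace X]
    (μ : Measure X) [IsFiniteMeasure μ] (f : X → ℝ) (hf : Continuous f) : Integrable f μ := by
  obtain ⟨C, hC⟩ := isCompact_univ.exists_bound_of_continuousOn hf.continuousOn
  exact Integrable.of_bound hf.aestronglyMeasurable C (Eventually.of_forall fun x => hC x (Set.mem_univ x))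

lemma Psi_cont (h : LD) (f : Torus2 → ℝ) (hf : Continuous f) : Continuous (Psi h f) := by
  unfold Psi
  have hc : Continuous fun w : UnitAddCircle × UnitAddCircle => f (h.e (w.2, w.1)) :=
    hf.comp (h.cont.comp (continuous_snd.prodMk continuous_fst))
  have := continuous_parametric_integral_of_continuous (μ := (volume : Measure UnitAddCircle))
    (f := fun y x => f (h.e (x, y))) (s := Set.univ) hc isCompact_univ
  simpa using this

lemma Psi_bd (h : LD) (f : Torus2 → ℝ) (hf : ∀ z, |f z| ≤ 1) (y : UnitAddCircle) : |Psi h f y| ≤ 1 := by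
  unfold Psi
  have := norm_integral_le_of_norm_le_const (μ := (volume : Measure UnitAddCircle)) (C := 1)
    (f := fun x => f (h.e (x, y))) (Eventually.of_forall fun x => hf _)
  simpa using this

lemma int_bd (f : Torus2 → ℝ) (hf : ∀ z, |f z| ≤ 1) : |∫ z, f z| ≤ 1 := by
  have := norm_integral_le_of_norm_le_const (μ := (volume : Measure Torus2)) (C := 1)
    (f := f) (Eventually.of_forall fun x => hf _)
  simpa using this

lemma int_comp (h : LD) (f : Torus2 → ℝ) (hf : Continuous f) : ∫ z, f (h.e z) = ∫ z, f z := by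
  have := integral_map (μ := (volume : Measure Torus2)) (φ := h.e) h.cont.measurable.aemeasurable
    (f := f) hf.aestronglyMeasurable
  rw [h.mp.map_eq] at this
  exact this.symm

lemma Psi_int (h : LD) (f : Torus2 → ℝ) (hf : Continuous f) : ∫ y, Psi h f y = ∫ z, f z := by
  rw [← int_comp h f hf]
  unfold Psi
  have := integral_prod_symm (μ := (volume : Measure UnitAddCircle)) (ν := (volume : Measure UnitAddCircle))
    (fun z : Torus2 => f (h.e z)) (integrable_of_cont _ _ (hf.comp h.cont))
  exact this.symm

lemma slice_lip (h : LD) (L : NNReal) (hL : LipschitzWith L h.e) (f : Torus2 → ℝ) (hf : LipschitzWith 1 f)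
    (u : Torus2) : LipschitzWith L (fun x : UnitAddCircle => f (h.e (u.1 + x, u.2))) := by
  have h1 : LipschitzWith 1 (fun x : UnitAddCircle => ((u.1 + x, u.2) : Torus2)) := by
    refine LipschitzWith.of_dist_le_mul fun x y => ?_
    simp [Prod.dist_eq]
  have := hf.comp (hL.comp h1)
  rw [one_mul, mul_one] at this
  exact this

lemma shift_avg (h : LD) (L : NNReal) (hL : LipschitzWith L h.e) (f : Torus2 → ℝ) (hf : LipschitzWith 1 f)
    (q : ℕ) (hq : 0 < q) (u : Torus2) :
    |∑ j ∈ Finset.range q, f (h.e (Rt (j / q) u)) - q * Psi h f u.2| ≤ L := by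
  have := riemann_sum q hq _ L (slice_lip h L hL f hf u)
  have e : ∫ x, f (h.e (u.1 + x, u.2)) = Psi h f u.2 :=
    integral_add_left_eq_self (fun x => f (h.e (x, u.2))) u.1
  rw [e] at this
  exact this

lemma mp_nsmul_add (q : ℕ) (hq : 0 < q) (c : UnitAddCircle) :
    MeasurePreserving (fun x : UnitAddCircle => q • x + c) volume volume := by
  rcases Nat.lt_or_ge 1 q with h | h
  · exact (AddCircle.ergodic_nsmul_add c h).toMeasurePreserving
  · have : q = 1 := by omega
    subst this
    simp only [one_smul]
    exact measurePreserving_add_right _ c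

lemma vol_strip (s : ℝ) : volume {x : UnitAddCircle | ‖x‖ ≤ s} ≤ ENNReal.ofReal (2 * s) := by
  have : {x : UnitAddCircle | ‖x‖ ≤ s} = Metric.closedBall 0 s := by ext; simp
  rw [this, AddCircle.volume_closedBall]
  exact ENNReal.ofReal_le_ofReal (min_le_right _ _)

/-- Two bounded functions agreeing off a small set have close integrals. -/
lemma int_close {X : Type*} [MeasurableSpace X] (μ : Measure X) [IsProbabilityMeasure μ] (u v : X → ℝ)
    (hu : Integrable u μ) (hv : Integrable v μ) (B : Set X) (hB : MeasurableSet B) (b C a : ℝ) (hb : μ B ≤ ENNReal.ofReal b)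
    (hb0 : 0 ≤ b) (hC : 0 ≤ C) (ha : 0 ≤ a) (h1 : ∀ x ∉ B, |u x - v x| ≤ a) (h2 : ∀ x, |u x - v x| ≤ C) :
    |∫ x, u x ∂μ - ∫ x, v x ∂μ| ≤ a + C * b := by
  rw [← integral_sub hu hv]
  have hi : Integrable (fun x => a + B.indicator (fun _ => C) x) μ :=
    (integrable_const _).add ((integrable_const _).indicator hB)
  calc |∫ x, (u x - v x) ∂μ| ≤ ∫ x, |u x - v x| ∂μ := abs_integral_le_integral_abs
    _ ≤ ∫ x, (a + B.indicator (fun _ => C) x) ∂μ := by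
        refine integral_mono (hu.sub hv).abs hi fun x => ?_
        by_cases hx : x ∈ B
        · simp [hx]; linarith [h2 x]
        · simp [hx]; exact h1 x hx
    _ = a + C * μ.real B := by
        rw [integral_add (integrable_const _) ((integrable_const _).indicator hB), integral_indicator hB]
        simp [mul_comm]
    _ ≤ a + C * b := by
        gcongr
        exact ENNReal.toReal_le_of_le_ofReal hb0 hb

lemma good_level (h : LD) (L : NNReal) (hL : LipschitzWith L h.e) (f : Torus2 → ℝ) (hf : LipschitzWith 1 f)
    (hf1 : ∀ z, |f z| ≤ 1) (P : BP) (c : UnitAddCircle) (hc : 3 * P.ε ≤ ‖c‖) :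
    |Psi (h.comp P.g) f c - ∫ z, f z| ≤ L / P.q + 12 * P.ε := by
  have hq : (0:ℝ) < P.q := by exact_mod_cast P.hq
  have hε := P.hε
  have hcomp : Continuous fun x : UnitAddCircle => P.g.e (x, c) := P.g.cont.comp (continuous_id.prodMk continuous_const)
  have hY : Continuous fun x : UnitAddCircle => (P.g.e (x, c)).2 := continuous_snd.comp hcomp
  -- step 1
  have s1 : |Psi (h.comp P.g) f c - ∫ x, Psi h f (P.g.e (x, c)).2| ≤ L / P.q := by
    have e1 : ∀ j : ℕ, ∫ x, f (h.e (Rt (j / P.q) (P.g.e (x, c)))) = Psi (h.comp P.g) f c := by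
      intro j
      have : ∀ x, f (h.e (Rt (j / P.q) (P.g.e (x, c)))) = f (h.e (P.g.e (x + ((j / P.q : ℝ) : UnitAddCircle), c))) := by
        intro x
        have := P.g_comm j (x, c)
        rw [Int.cast_natCast] at this
        rw [← this]; rfl
      simp_rw [this]
      exact integral_add_right_eq_self (fun x => f (h.e (P.g.e (x, c)))) _
    have hRc : ∀ t, Continuous (Rt t) := fun t => by unfold Rt; fun_prop
    have hci : ∀ j : ℕ, Integrable (fun x => f (h.e (Rt (j / P.q) (P.g.e (x, c))))) (volume : Measure UnitAddCircle) := fun j =>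
      integrable_of_cont _ _ (hf.continuous.comp (h.cont.comp ((hRc _).comp hcomp)))
    have e2 : Psi (h.comp P.g) f c = ∫ x, (P.q:ℝ)⁻¹ * ∑ j ∈ Finset.range P.q, f (h.e (Rt (j / P.q) (P.g.e (x, c)))) := by
      rw [integral_const_mul, integral_finsetSum _ (fun j _ => hci j)]
      simp_rw [e1]
      rw [Finset.sum_const, Finset.card_range, nsmul_eq_mul]
      field_simp
    rw [e2]
    have := int_close (volume : Measure UnitAddCircle)
      (fun x => (P.q:ℝ)⁻¹ * ∑ j ∈ Finset.range P.q, f (h.e (Rt (j / P.q) (P.g.e (x, c)))))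
      (fun x => Psi h f (P.g.e (x, c)).2) ((integrable_finsetSum _ (fun j _ => hci j)).const_mul _)
      (integrable_of_cont _ _ ((Psi_cont h f hf.continuous).comp hY)) ∅ MeasurableSet.empty 0 (L / P.q) (L / P.q) (by simp)
      le_rfl (by positivity) (by positivity) ?_ ?_
    · simpa using this
    all_goals
      intro x
      have h1 := shift_avg h L hL f hf P.q P.hq (P.g.e (x, c))
      have h2 : (P.q:ℝ)⁻¹ * ∑ j ∈ Finset.range P.q, f (h.e (Rt (j / P.q) (P.g.e (x, c)))) - Psi h f (P.g.e (x, c)).2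
        = (P.q:ℝ)⁻¹ * (∑ j ∈ Finset.range P.q, f (h.e (Rt (j / P.q) (P.g.e (x, c)))) - P.q * Psi h f (P.g.e (x, c)).2) := by
        field_simp
      rw [h2, abs_mul, abs_of_pos (by positivity), inv_mul_eq_div]
      try intro _
      gcongr
  have hmp := mp_nsmul_add P.q P.hq c
  have hcq : Continuous fun x : UnitAddCircle => P.q • x + c := by fun_prop
  have s2 : |(∫ x, Psi h f (P.g.e (x, c)).2) - ∫ x, Psi h f (P.q • x + c)| ≤ 0 + 2 * (6 * P.ε) := by
    refine int_close _ _ _ (integrable_of_cont _ _ ((Psi_cont h f hf.continuous).comp hY))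
      (integrable_of_cont _ _ ((Psi_cont h f hf.continuous).comp hcq))
      ((fun x : UnitAddCircle => P.q • x + c) ⁻¹' {x : UnitAddCircle | ‖x‖ ≤ 3 * P.ε})
      (hcq.measurable (isClosed_le continuous_norm continuous_const).measurableSet)
      _ _ _ ?_ (by positivity) (by norm_num) le_rfl ?_ ?_
    · rw [hmp.measure_preimage (isClosed_le continuous_norm continuous_const).measurableSet.nullMeasurableSet]
      refine (vol_strip _).trans (le_of_eq ?_)
      congr 1; ring
    · intro x hx
      have hx' : 3 * P.ε < ‖P.q • x + c‖ := by simpa using hx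
      have := (P.g_out (x, c) hc).1 (by rw [add_comm]; exact hx'.le)
      simp only at this
      show |Psi h f (P.g.e (x, c)).2 - Psi h f (P.q • x + c)| ≤ 0
      rw [this, add_comm]; simp
    · intro x
      have a1 := abs_le.1 (Psi_bd h f hf1 (P.g.e (x, c)).2)
      have a2 := abs_le.1 (Psi_bd h f hf1 (P.q • x + c))
      show |Psi h f (P.g.e (x, c)).2 - Psi h f (P.q • x + c)| ≤ 2
      rw [abs_le]; constructor <;> linarith [a1.1, a1.2, a2.1, a2.2]
  have s3 : ∫ x, Psi h f (P.q • x + c) = ∫ z, f z := by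
    rw [← Psi_int h f hf.continuous]
    have := integral_map (μ := (volume : Measure UnitAddCircle)) hcq.measurable.aemeasurable
      (f := Psi h f) (Psi_cont h f hf.continuous).aestronglyMeasurable
    rw [hmp.map_eq] at this
    exact this.symm
  rw [s3] at s2
  have := abs_sub_le (Psi (h.comp P.g) f c) (∫ x, Psi h f (P.g.e (x, c)).2) (∫ z, f z)
  linarith

lemma Rt_dist (s t : ℝ) (z : Torus2) : dist (Rt s z) (Rt t z) ≤ |s - t| := by
  unfold Rt
  simp only [Prod.dist_eq, dist_self, dist_add_left]
  exact max_le (dist_coe_le _ _) (abs_nonneg _)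

/-- averages along the orbit of `h R_{p/q+θ} h⁻¹`, in `h`-coordinates -/
lemma orbit_avg (h : LD) (L L' : NNReal) (hL : LipschitzWith L h.e) (P : BP)
    (hL' : LipschitzWith L' (h.comp P.g).e) (f : Torus2 → ℝ) (hf : LipschitzWith 1 f)
    (hf1 : ∀ z, |f z| ≤ 1) (p : ℤ) (hp : IsCoprime p (P.q : ℤ)) (θ : ℝ) (hθ : 0 ≤ θ) (w : Torus2) (N : ℕ) :
    |∑ i ∈ Finset.range N, f ((h.comp P.g).e (Rt (i * (p / P.q + θ)) w))
      - ∑ i ∈ Finset.range N, Psi h f (P.g.e (Rt (i * θ) w)).2| ≤ 2 * P.q + N * (L' * (P.q * θ) + L / P.q) := by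
  have hq : (0:ℝ) < P.q := by exact_mod_cast P.hq
  set Φ : ℕ → ℝ := fun i => f ((h.comp P.g).e (Rt (i * (p / P.q + θ)) w)) with hΦ
  have w1 := window_sum Φ (fun i => hf1 _) P.q N
  have w2 : ∀ i : ℕ, |∑ j ∈ Finset.range P.q, Φ (i + j) - P.q * Psi h f (P.g.e (Rt (i * θ) w)).2| ≤
      P.q * (L' * (P.q * θ) + L / P.q) := by
    intro i
    have a1 : |∑ j ∈ Finset.range P.q, Φ (i + j) - ∑ j ∈ Finset.range P.q,
        f ((h.comp P.g).e (Rt ((i + j) * (p / P.q)) (Rt (i * θ) w)))| ≤ P.q * (L' * (P.q * θ)) := by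
      rw [← Finset.sum_sub_distrib]
      refine (Finset.abs_sum_le_sum_abs _ _).trans ?_
      have hcst : (P.q : ℝ) * (L' * (P.q * θ)) = ∑ j ∈ Finset.range P.q, (L' * (P.q * θ) : ℝ) := by simp
      rw [hcst]
      refine Finset.sum_le_sum fun j hj => ?_
      have hj' : (j:ℝ) ≤ P.q := by
        have : j < P.q := by simpa using hj
        exact_mod_cast this.le
      rw [hΦ, Rt_add, ← Real.dist_eq]
      have b1 := hf.dist_le_mul ((h.comp P.g).e (Rt ((i + j : ℕ) * (p / P.q + θ)) w)) ((h.comp P.g).e (Rt ((i + j) * (p / P.q) + i * θ) w))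
      have b2 := hL'.dist_le_mul (Rt ((i + j : ℕ) * (p / P.q + θ)) w) (Rt ((i + j) * (p / P.q) + i * θ) w)
      have b3 := Rt_dist ((i + j : ℕ) * (p / P.q + θ)) ((i + j) * (p / P.q) + i * θ) w
      have b4 : (((i + j : ℕ) * (p / P.q + θ)) - ((i + j) * (p / P.q) + i * θ) : ℝ) = j * θ := by push_cast; ring
      rw [b4, abs_of_nonneg (by positivity)] at b3
      simp only [NNReal.coe_one, one_mul] at b1
      refine b1.trans (b2.trans ?_)
      gcongr
      exact b3.trans (by gcongr)
    have a2 : ∑ j ∈ Finset.range P.q, f ((h.comp P.g).e (Rt ((i + j) * (p / P.q)) (Rt (i * θ) w))) =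
        ∑ j ∈ Finset.range P.q, f (h.e (Rt (j / P.q) (P.g.e (Rt (i * θ) w)))) := by
      have := perm_sum p P.q P.hq hp (fun x => f ((h.comp P.g).e ((Rt (i * θ) w).1 + x, (Rt (i * θ) w).2))) i
      refine Eq.trans ?_ (this.trans ?_)
      · simp only [Int.cast_natCast]; rfl
      · refine Finset.sum_congr rfl fun j _ => ?_
        have := P.g_comm j (Rt (i * θ) w)
        rw [Int.cast_natCast] at this
        rw [← this]; rfl
    have a3 := shift_avg h L hL f hf P.q P.hq (P.g.e (Rt (i * θ) w))
    rw [a2] at a1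
    have a4 := abs_sub_le (∑ j ∈ Finset.range P.q, Φ (i + j)) (∑ j ∈ Finset.range P.q, f (h.e (Rt (j / P.q) (P.g.e (Rt (i * θ) w)))))
      (P.q * Psi h f (P.g.e (Rt (i * θ) w)).2)
    have : P.q * (L' * (P.q * θ) + L / P.q) = P.q * (L' * (P.q * θ)) + L := by field_simp
    rw [this]
    linarith
  have w3 : |∑ i ∈ Finset.range N, ∑ j ∈ Finset.range P.q, Φ (i + j) - P.q * ∑ i ∈ Finset.range N, Psi h f (P.g.e (Rt (i * θ) w)).2|
      ≤ N * (P.q * (L' * (P.q * θ) + L / P.q)) := by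
    rw [Finset.mul_sum, ← Finset.sum_sub_distrib]
    refine (Finset.abs_sum_le_sum_abs _ _).trans ((Finset.sum_le_sum fun i _ => w2 i).trans ?_)
    simp
  have w4 := abs_sub_le (P.q * ∑ i ∈ Finset.range N, Φ i) (∑ i ∈ Finset.range N, ∑ j ∈ Finset.range P.q, Φ (i + j))
    (P.q * ∑ i ∈ Finset.range N, Psi h f (P.g.e (Rt (i * θ) w)).2)
  rw [← mul_sub, abs_mul, abs_of_pos hq] at w4
  refine le_of_mul_le_mul_left (a := (P.q:ℝ)) ?_ hq
  calc _ ≤ _ := w4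
    _ ≤ P.q * (2 * P.q) + N * (P.q * (L' * (P.q * θ) + L / P.q)) := add_le_add w1 w3
    _ = _ := by ring

/-- the main generic estimate -/
lemma generic_avg (h : LD) (L L' : NNReal) (hL : LipschitzWith L h.e) (P : BP)
    (hL' : LipschitzWith L' (h.comp P.g).e) (f : Torus2 → ℝ) (hf : LipschitzWith 1 f)
    (hf1 : ∀ z, |f z| ≤ 1) (p : ℤ) (hp : IsCoprime p (P.q : ℤ)) (θ : ℝ) (hθ : 0 < θ) (w : Torus2) (N : ℕ) (I : ℝ)
    (hI : |I| ≤ 1) (ε0 κ K : ℝ) (hε0 : P.ε ≤ ε0) (hκ : 0 ≤ κ) (hK : 5 < K) (hK2 : K * ε0 ≤ 1/2) (hθ2 : P.q * θ ≤ ε0)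
    (hgood : ∀ c, 5 * ε0 ≤ ‖c‖ → |Psi h f c - I| ≤ κ)
    (hw : 3 * P.ε ≤ ‖w.2‖) (hw2 : K * ε0 ≤ ‖(P.g.e w).2‖) :
    |∑ i ∈ Finset.range N, f ((h.comp P.g).e (Rt (i * (p / P.q + θ)) w)) - N * I| ≤
      2 * P.q + N * (L' * (P.q * θ) + L / P.q + κ + 22 / (K - 5)) := by
  classical
  have hq : (0:ℝ) < P.q := by exact_mod_cast P.hq
  have hε := P.hε
  have hε00 : 0 < ε0 := by linarith
  have o := orbit_avg h L L' hL P hL' f hf hf1 p hp θ hθ.le w N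
  obtain ⟨v, hv⟩ := QuotientAddGroup.mk_surjective (w.2 + P.q • w.1)
  change (v : UnitAddCircle) = w.2 + P.q • w.1 at hv
  have hv2 : K * ε0 ≤ ‖(v : UnitAddCircle)‖ := by
    rw [hv]
    rcases le_or_gt (3 * P.ε) ‖w.2 + P.q • w.1‖ with h1 | h1
    · rw [← (P.g_out w hw).1 h1]; exact hw2
    · have := (P.g_out w hw).2 h1
      nlinarith
  have cs := count_strip v (P.q * θ) (5 * ε0) (K * ε0) N (by positivity) (by positivity) (by nlinarith) hK2 hv2
  set B := (Finset.range N).filter fun i : ℕ => ‖((v + i * (P.q * θ) : ℝ) : UnitAddCircle)‖ < 5 * ε0 with hB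
  have hterm : ∀ i ∈ Finset.range N, |Psi h f (P.g.e (Rt (i * θ) w)).2 - I| ≤ κ + if i ∈ B then 2 else 0 := by
    intro i hi
    have hpos : (Rt (i * θ) w).2 + P.q • (Rt (i * θ) w).1 = ((v + i * (P.q * θ) : ℝ) : UnitAddCircle) := by
      rw [coe_add', hv]
      show w.2 + P.q • (w.1 + ((i * θ : ℝ) : UnitAddCircle)) = _
      rw [smul_add, ← BP.coe_nat_mul, add_assoc]
      congr 3; ring
    by_cases hiB : i ∈ B
    · rw [if_pos hiB]
      have a1 := abs_le.1 (Psi_bd h f hf1 (P.g.e (Rt (i * θ) w)).2)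
      have a2 := abs_le.1 hI
      rw [abs_le]; constructor <;> linarith [a1.1, a1.2, a2.1, a2.2]
    · rw [if_neg hiB, add_zero]
      apply hgood
      have h5 : 5 * ε0 ≤ ‖((v + i * (P.q * θ) : ℝ) : UnitAddCircle)‖ := by
        by_contra hcon
        exact hiB (Finset.mem_filter.2 ⟨hi, not_le.1 hcon⟩)
      rw [(P.g_out (Rt (i * θ) w) hw).1 (by rw [hpos]; linarith), hpos]
      exact h5
  have hsum : |∑ i ∈ Finset.range N, Psi h f (P.g.e (Rt (i * θ) w)).2 - N * I| ≤ N * κ + 2 * B.card := by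
    have e : (N:ℝ) * I = ∑ i ∈ Finset.range N, I := by simp
    rw [e, ← Finset.sum_sub_distrib]
    refine (Finset.abs_sum_le_sum_abs _ _).trans ((Finset.sum_le_sum hterm).trans (le_of_eq ?_))
    rw [Finset.sum_add_distrib, Finset.sum_ite_mem, Finset.inter_eq_right.2 (Finset.filter_subset _ _)]
    rw [Finset.sum_const, Finset.sum_const, Finset.card_range, nsmul_eq_mul, nsmul_eq_mul, mul_comm (B.card : ℝ)]
  have hcard : (B.card : ℝ) ≤ N * (11 / (K - 5)) := by
    have hk : 0 < K - 5 := by linarith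
    have h1 : (B.card : ℝ) * (K - 5) * ε0 ≤ N * 11 * ε0 := by
      calc (B.card : ℝ) * (K - 5) * ε0 = (B.card : ℝ) * (K * ε0 - 5 * ε0) := by ring
        _ ≤ _ := cs
        _ ≤ N * (2 * (5 * ε0) + ε0) := by gcongr
        _ = _ := by ring
    have h2 := le_of_mul_le_mul_right h1 hε00
    rw [← mul_div_assoc, le_div_iff₀ hk]; exact h2
  have t := abs_sub_le (∑ i ∈ Finset.range N, f ((h.comp P.g).e (Rt (i * (p / P.q + θ)) w)))
    (∑ i ∈ Finset.range N, Psi h f (P.g.e (Rt (i * θ) w)).2) (N * I)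
  have e : 22 / (K - 5) = 2 * (11 / (K - 5)) := by ring
  rw [e]
  linarith

/-! ### Part 6: coverings and dimension -/

/-- `S` has a countable cover by sets of diameter `≤ δ` with total `a`-cost `≤ δ`. -/
def Cov (a δ : ℝ) (S : Set Torus2) : Prop :=
  ∃ t : ℕ → Set Torus2, S ⊆ ⋃ i, t i ∧ (∀ i, Metric.ediam (t i) ≤ ENNReal.ofReal δ) ∧
    ∑' i, Metric.ediam (t i) ^ a ≤ ENNReal.ofReal δ

lemma Cov.mono {a δ : ℝ} {S S' : Set Torus2} (h : Cov a δ S) (hs : S' ⊆ S) : Cov a δ S' := by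
  obtain ⟨t, h1, h2, h3⟩ := h
  exact ⟨t, hs.trans h1, h2, h3⟩

lemma ediam_image_ball (h : LD) (L : NNReal) (hL : LipschitzWith L h.e) (c : Torus2) (r : ℝ) :
    Metric.ediam (h.e '' Metric.closedBall c r) ≤ ENNReal.ofReal (2 * L * r) := by
  apply Metric.ediam_le
  rintro _ ⟨x, hx, rfl⟩ _ ⟨y, hy, rfl⟩
  rw [edist_dist]
  apply ENNReal.ofReal_le_ofReal
  have h1 := hL.dist_le_mul x y
  have h2 : dist x y ≤ 2 * r := by
    have := dist_triangle_right x y c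
    rw [Metric.mem_closedBall] at hx hy
    linarith
  calc _ ≤ _ := h1
    _ ≤ L * (2 * r) := by gcongr
    _ = _ := by ring

def curveSet (q : ℕ) (K ε : ℝ) : Set Torus2 := {u | ‖u.2 - q • u.1‖ ≤ (K + 2) * ε ∨ ‖u.2‖ ≤ 3 * ε}

lemma exists_near (J : ℕ) (hJ : 0 < J) (x : UnitAddCircle) : ∃ j < J, ∃ d : ℝ, 0 ≤ d ∧ d ≤ 1 / J ∧
    x = ((j / J + d : ℝ) : UnitAddCircle) := by
  obtain ⟨x, rfl⟩ := QuotientAddGroup.mk_surjective x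
  have hJ' : (0:ℝ) < J := by exact_mod_cast hJ
  have f0 := Int.fract_nonneg x
  have f1 := Int.fract_lt_one x
  have g1 := Nat.floor_le (mul_nonneg f0 hJ'.le)
  have g2 := Nat.lt_floor_add_one (Int.fract x * J)
  refine ⟨⌊Int.fract x * J⌋₊, ?_, Int.fract x - ⌊Int.fract x * J⌋₊ / J, ?_, ?_, ?_⟩
  · rw [Nat.floor_lt (mul_nonneg f0 hJ'.le)]
    nlinarith
  · rw [sub_nonneg, div_le_iff₀ hJ']; exact g1
  · rw [sub_le_iff_le_add, ← add_div, le_div_iff₀ hJ']; linarith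
  · have : ((⌊Int.fract x * J⌋₊ : ℝ) / J + (Int.fract x - ⌊Int.fract x * J⌋₊ / J)) = x + ((-⌊x⌋ : ℤ) : ℝ) := by
      rw [Int.fract]; push_cast; ring
    rw [this, coe_add', coe_int_zero, add_zero]
    try rfl

lemma curve_cover (q J : ℕ) (hJ : 0 < J) (K ε : ℝ) (hK : 0 ≤ K) (hε : 0 < ε) (hJε : 1 / (J:ℝ) ≤ ε) :
    curveSet q K ε ⊆ ⋃ j ∈ Finset.range J,
      (Metric.closedBall ((((j / J : ℝ) : UnitAddCircle), ((q * (j / J) : ℝ) : UnitAddCircle)) : Torus2) ((q + K + 3) * ε) ∪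
       Metric.closedBall ((((j / J : ℝ) : UnitAddCircle), 0) : Torus2) ((q + K + 3) * ε)) := by
  rintro ⟨x, y⟩ hxy
  obtain ⟨j, hj, d, hd0, hd1, rfl⟩ := exists_near J hJ x
  have hqε : 0 ≤ q * ε := by positivity
  have hKε : 0 ≤ K * ε := by positivity
  have hd : d ≤ ε := hd1.trans hJε
  have hx : dist ((j / J + d : ℝ) : UnitAddCircle) ((j / J : ℝ) : UnitAddCircle) ≤ (q + K + 3) * ε := by
    refine (dist_coe_le _ _).trans ?_
    rw [add_sub_cancel_left, abs_of_nonneg hd0]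
    nlinarith
  simp only [Set.mem_iUnion, Finset.mem_range, Set.mem_union, Metric.mem_closedBall, Prod.dist_eq, max_le_iff]
  refine ⟨j, hj, ?_⟩
  rcases hxy with h | h
  · left
    refine ⟨hx, ?_⟩
    change ‖y - q • ((j / J + d : ℝ) : UnitAddCircle)‖ ≤ (K + 2) * ε at h
    rw [← BP.coe_nat_mul] at h
    rw [← dist_eq_norm] at h
    have h2 : dist ((q * (j / J + d) : ℝ) : UnitAddCircle) ((q * (j / J) : ℝ) : UnitAddCircle) ≤ q * ε := by
      refine (dist_coe_le _ _).trans ?_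
      have : (q * (j / J + d) - q * (j / J) : ℝ) = q * d := by ring
      rw [this, abs_of_nonneg (by positivity)]
      gcongr
    have := dist_triangle y ((q * (j / J + d) : ℝ) : UnitAddCircle) ((q * (j / J) : ℝ) : UnitAddCircle)
    show dist y _ ≤ _
    nlinarith
  · right
    refine ⟨hx, ?_⟩
    change ‖y‖ ≤ 3 * ε at h
    show dist y 0 ≤ _
    rw [dist_zero_right]
    nlinarith

lemma cov_bound (h : LD) (L : NNReal) (hL : LipschitzWith L h.e) (q : ℕ) (a K ε δ : ℝ) (ha : 1 < a) (hK : 0 ≤ K)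
    (hε : 0 < ε) (hε1 : ε ≤ 1) (h1 : 2 * L * ((q + K + 3) * ε) ≤ δ)
    (h2 : 4 / ε * (2 * L * ((q + K + 3) * ε)) ^ a ≤ δ) : Cov a δ (h.e '' curveSet q K ε) := by
  set J := ⌈1 / ε⌉₊ with hJ
  have hJ0 : 0 < J := Nat.ceil_pos.2 (by positivity)
  have hJ0' : (0:ℝ) < J := by exact_mod_cast hJ0
  have hJ1 : 1 / ε ≤ J := Nat.le_ceil _
  have hJ2 : (J:ℝ) ≤ 2 / ε := by
    have := Nat.ceil_lt_add_one (show 0 ≤ 1 / ε by positivity)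
    have h3 : 1 ≤ 1 / ε := by rw [le_div_iff₀ hε]; linarith
    have h4 : 2 / ε = 1 / ε + 1 / ε := by ring
    linarith
  have hJε : 1 / (J:ℝ) ≤ ε := by
    rw [div_le_iff₀ hJ0']; rw [div_le_iff₀ hε] at hJ1; linarith
  set R := (q + K + 3) * ε with hR
  have hR0 : 0 ≤ 2 * L * R := by positivity
  let B1 : ℕ → Set Torus2 := fun j => h.e '' Metric.closedBall ((((j / J : ℝ) : UnitAddCircle), ((q * (j / J) : ℝ) : UnitAddCircle)) : Torus2) R
  let B2 : ℕ → Set Torus2 := fun j => h.e '' Metric.closedBall ((((j / J : ℝ) : UnitAddCircle), 0) : Torus2) R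
  let t : ℕ → Set Torus2 := fun i => if i < 2 * J then (if i < J then B1 i else B2 (i - J)) else ∅
  have ht : ∀ i, Metric.ediam (t i) ≤ ENNReal.ofReal (2 * L * R) := by
    intro i
    simp only [t]
    split_ifs
    · exact ediam_image_ball h L hL _ _
    · exact ediam_image_ball h L hL _ _
    · simp
  refine ⟨t, ?_, fun i => (ht i).trans (ENNReal.ofReal_le_ofReal h1), ?_⟩
  · rintro _ ⟨u, hu, rfl⟩
    have := curve_cover q J hJ0 K ε hK hε hJε hu
    simp only [Set.mem_iUnion, Finset.mem_range] at this
    obtain ⟨j, hj, hu | hu⟩ := this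
    · refine Set.mem_iUnion.2 ⟨j, ?_⟩
      simp only [t]
      rw [if_pos (by omega), if_pos hj]
      exact ⟨u, hu, rfl⟩
    · refine Set.mem_iUnion.2 ⟨j + J, ?_⟩
      simp only [t]
      rw [if_pos (by omega), if_neg (by omega), Nat.add_sub_cancel]
      exact ⟨u, hu, rfl⟩
  · rw [tsum_eq_sum (s := Finset.range (2 * J))]
    · calc _ ≤ ∑ i ∈ Finset.range (2 * J), ENNReal.ofReal ((2 * L * R) ^ a) := by
            refine Finset.sum_le_sum fun i _ => ?_
            rw [← ENNReal.ofReal_rpow_of_nonneg hR0 (by linarith)]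
            exact ENNReal.rpow_le_rpow (ht i) (by linarith)
        _ = ENNReal.ofReal ((2 * J : ℕ) * (2 * L * R) ^ a) := by
            rw [Finset.sum_const, Finset.card_range, nsmul_eq_mul, ENNReal.ofReal_mul (by positivity), ENNReal.ofReal_natCast]
        _ ≤ ENNReal.ofReal δ := by
            apply ENNReal.ofReal_le_ofReal
            refine le_trans ?_ h2
            have h4 : 4 / ε = 2 * (2 / ε) := by ring
            push_cast
            gcongr
            linarith
    · intro i hi
      have : ¬ i < 2 * J := by simpa using hi
      simp only [t]
      rw [if_neg this, Metric.ediam_empty]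
      exact ENNReal.zero_rpow_of_pos (by linarith)

lemma cov_eventually (h : LD) (L : NNReal) (hL : LipschitzWith L h.e) (q : ℕ) (a K δ : ℝ) (ha : 1 < a) (hK : 0 ≤ K)
    (hδ : 0 < δ) : ∀ᶠ ε in 𝓝[>] (0:ℝ), Cov a δ (h.e '' curveSet q K ε) := by
  have t1 : Tendsto (fun ε : ℝ => 2 * L * ((q + K + 3) * ε)) (𝓝[>] 0) (𝓝 0) := by
    have : Tendsto (fun ε : ℝ => 2 * L * ((q + K + 3) * ε)) (𝓝 0) (𝓝 (2 * L * ((q + K + 3) * 0))) :=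
      Continuous.tendsto (by fun_prop) 0
    simp only [mul_zero] at this
    exact this.mono_left nhdsWithin_le_nhds
  have t2 : Tendsto (fun ε : ℝ => 4 * (2 * L * (q + K + 3)) ^ a * ε ^ (a - 1)) (𝓝[>] 0) (𝓝 0) := by
    have h0 : Tendsto (fun ε : ℝ => ε ^ (a - 1)) (𝓝 0) (𝓝 (0 ^ (a - 1))) :=
      (Real.continuousAt_rpow_const _ _ (Or.inr (by linarith))).tendsto
    rw [Real.zero_rpow (by linarith)] at h0
    have := (h0.const_mul (4 * (2 * L * (q + K + 3)) ^ a))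
    rw [mul_zero] at this
    exact this.mono_left nhdsWithin_le_nhds
  filter_upwards [t1.eventually (eventually_le_nhds hδ), t2.eventually (eventually_le_nhds hδ), self_mem_nhdsWithin,
    nhdsWithin_le_nhds (eventually_le_nhds (show (0:ℝ) < 1 by norm_num))] with ε h1 h2 h3 h4
  have h3' : 0 < ε := h3
  refine cov_bound h L hL q a K ε δ ha hK h3 h4 h1 ?_
  refine le_trans (le_of_eq ?_) h2
  rw [← mul_assoc (2 * (L:ℝ)), Real.mul_rpow (by positivity) h3'.le, Real.rpow_sub h3', Real.rpow_one]
  field_simp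

lemma dimH_limsup_le (a : ℝ) (ha : 0 < a) (S : Set Torus2) (W : ℕ → Set Torus2)
    (hW : ∀ n, Cov a ((1/2)^n) (W n)) (hS : ∀ n, S ⊆ ⋃ m, W (n + m)) : dimH S ≤ ENNReal.ofReal a := by
  choose t h1 h2 h3 using hW
  have key := Measure.hausdorffMeasure_le_liminf_tsum (X := Torus2) (β := ℕ) (ι := fun _ => ℕ × ℕ) a S (l := atTop)
    (fun n => ENNReal.ofReal ((1/2)^n)) (by
      have : Tendsto (fun n : ℕ => ((1:ℝ)/2)^n) atTop (𝓝 0) := tendsto_pow_atTop_nhds_zero_of_lt_one (by norm_num) (by norm_num)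
      have := ENNReal.tendsto_ofReal this
      simpa using this) (fun n i => t (n + i.1) i.2) (Eventually.of_forall fun n i => by
      refine (h2 _ _).trans (ENNReal.ofReal_le_ofReal ?_)
      exact pow_le_pow_of_le_one (by norm_num) (by norm_num) (by omega)) (Eventually.of_forall fun n x hx => by
      obtain ⟨m, hm⟩ := Set.mem_iUnion.1 (hS n hx)
      obtain ⟨i, hi⟩ := Set.mem_iUnion.1 (h1 _ hm)
      exact Set.mem_iUnion.2 ⟨(m, i), hi⟩)
  have hb : ∀ n : ℕ, ∑' i : ℕ × ℕ, Metric.ediam (t (n + i.1) i.2) ^ a ≤ 2 := by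
    intro n
    rw [ENNReal.tsum_prod (f := fun m i => Metric.ediam (t (n + m) i) ^ a)]
    calc _ ≤ ∑' m : ℕ, ENNReal.ofReal ((1/2)^m) := by
          refine ENNReal.tsum_le_tsum fun m => (h3 (n + m)).trans (ENNReal.ofReal_le_ofReal ?_)
          exact pow_le_pow_of_le_one (by norm_num) (by norm_num) (by omega)
      _ = 2 := by
          rw [← ENNReal.ofReal_tsum_of_nonneg (fun n => by positivity) summable_geometric_two, tsum_geometric_two]
          simp
  have hfin : μH[((Real.toNNReal a : NNReal) : ℝ)] S ≠ ⊤ := by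
    rw [Real.coe_toNNReal a ha.le]
    refine ne_of_lt (lt_of_le_of_lt (key.trans ?_) (show (2:ℝ≥0∞) < ⊤ by simp))
    exact liminf_le_of_le (by isBoundedDefault) (fun b hb' => by
      obtain ⟨n, hn⟩ := hb'.exists
      exact hn.trans (hb n))
  exact dimH_le_of_hausdorffMeasure_ne_top hfin

lemma one_le_dimH (s : Set UnitAddCircle) (hs : volume s ≠ 0) : 1 ≤ dimH s := by
  have h1 : (2:ℝ≥0∞)⁻¹ • (volume : Measure UnitAddCircle) ≤ μH[1] := by
    refine Measure.le_hausdorffMeasure 1 _ 1 one_pos fun t ht => ?_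
    rw [ENNReal.rpow_one]
    rcases t.eq_empty_or_nonempty with rfl | ⟨x, hx⟩
    · simp
    have hne : Metric.ediam t ≠ ⊤ := ne_of_lt (lt_of_le_of_lt ht (by simp))
    have hsub : t ⊆ Metric.closedBall x (Metric.ediam t).toReal := by
      intro y hy
      rw [Metric.mem_closedBall, dist_edist]
      exact ENNReal.toReal_mono hne (Metric.edist_le_ediam_of_mem hy hx)
    have h2 : volume t ≤ 2 * Metric.ediam t := by
      refine (measure_mono hsub).trans ?_
      rw [AddCircle.volume_closedBall]
      refine (ENNReal.ofReal_le_ofReal (min_le_right _ _)).trans ?_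
      rw [ENNReal.ofReal_mul (by norm_num), ENNReal.ofReal_toReal hne]
      simp
    rw [Measure.smul_apply, smul_eq_mul]
    calc _ ≤ (2:ℝ≥0∞)⁻¹ * (2 * Metric.ediam t) := by gcongr
      _ = Metric.ediam t := by
        rw [← mul_assoc, ENNReal.inv_mul_cancel (by simp) (by simp), one_mul]
  have h2 : μH[((1 : NNReal) : ℝ)] s ≠ 0 := by
    rw [NNReal.coe_one]
    intro h0
    have := h1 s
    rw [h0, Measure.smul_apply, smul_eq_mul] at this
    simp at this
    exact hs this
  simpa using le_dimH_of_hausdorffMeasure_ne_zero h2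

lemma strip_vol (h : LD) (s : ℝ) : volume {z : Torus2 | ‖(h.e.symm z).2‖ ≤ s} ≤ ENNReal.ofReal (2 * s) := by
  have e : {z : Torus2 | ‖(h.e.symm z).2‖ ≤ s} = h.e '' {u : Torus2 | ‖u.2‖ ≤ s} := by
    ext z; constructor
    · intro hz; exact ⟨h.e.symm z, hz, by simp⟩
    · rintro ⟨u, hu, rfl⟩; simpa using hu
  have hcl : IsClosed {u : Torus2 | ‖u.2‖ ≤ s} := isClosed_le (by fun_prop) continuous_const
  have hm : MeasurableSet (h.e '' {u : Torus2 | ‖u.2‖ ≤ s}) := (hcl.isCompact.image h.cont).measurableSet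
  have := h.mp.measure_preimage hm.nullMeasurableSet
  rw [h.e.injective.preimage_image] at this
  rw [e, ← this]
  have e2 : {u : Torus2 | ‖u.2‖ ≤ s} = Set.univ ×ˢ {x : UnitAddCircle | ‖x‖ ≤ s} := by ext; simp
  rw [e2]
  have := Measure.prod_prod (μ := (volume : Measure UnitAddCircle)) (ν := (volume : Measure UnitAddCircle)) Set.univ {x : UnitAddCircle | ‖x‖ ≤ s}
  refine le_trans (le_of_eq this) ?_
  simpa using vol_strip s

/-! ### Part 7: the inductive construction -/

def KK (n : ℕ) : ℝ := 11 * 2 ^ n + 5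

structure St where
  h : LD
  P : BP
  p : ℤ
  hp : IsCoprime p (P.q : ℤ)

namespace St
def L (s : St) : NNReal := Classical.choose s.h.lip
lemma hL (s : St) : LipschitzWith s.L s.h.e := Classical.choose_spec s.h.lip
/-- rotation number -/
def r (s : St) : ℝ := s.p / s.P.q
end St

structure Step (a : ℝ) (n : ℕ) (s s' : St) : Prop where
  h_eq : s'.h = s.h.comp s'.P.g
  r_eq : s'.r = s.r + 1 / s'.P.q
  η_eq : s'.P.η = (1/2) ^ (n + 6)
  ε_le : s'.P.ε ≤ s.P.ε
  ε_K : KK (n + 1) * s'.P.ε ≤ (1/2) ^ (n + 2)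
  q_big : 4 ^ n * s.L * s.P.q ≤ (s'.P.q : ℝ)
  q_eps : (s.P.q : ℝ) ≤ s.P.ε * s'.P.q
  sm : ∀ k ≤ n, ∀ p, ‖iteratedFDeriv ℝ k (s.h.Del s.r s'.r) p‖ ≤ (1/2) ^ n
  smi : ∀ k ≤ n, ∀ p, ‖iteratedFDeriv ℝ k (s.h.Del (-s.r) (-s'.r)) p‖ ≤ (1/2) ^ n
  cov : Cov a ((1/2) ^ n) (s.h.e '' curveSet s'.P.q (KK (n + 1)) s'.P.ε)

lemma exists_step (a : ℝ) (ha : 1 < a) (n : ℕ) (s : St) : ∃ s' : St, Step a n s s' := by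
  have hq := s.P.hq
  have hq' : (0:ℝ) < s.P.q := by exact_mod_cast hq
  have hε := s.P.hε
  let Q : ℕ → ℕ := fun l => s.P.q * (s.P.q * l)
  have hQ : Tendsto (fun l : ℕ => (Q l : ℝ)) atTop atTop := by
    have : (fun l : ℕ => (Q l : ℝ)) = fun l : ℕ => ((s.P.q : ℝ) * s.P.q) * (l:ℝ) := by
      funext l; simp only [Q]; push_cast; ring
    rw [this]
    exact tendsto_natCast_atTop_atTop.const_mul_atTop (by positivity)
  have hr : Tendsto (fun l : ℕ => s.r + 1 / (Q l : ℝ)) atTop (𝓝 s.r) := by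
    have := (tendsto_const_nhds (x := s.r)).add (hQ.const_div_atTop 1)
    simpa using this
  have hri : Tendsto (fun l : ℕ => -(s.r + 1 / (Q l : ℝ))) atTop (𝓝 (-s.r)) := hr.neg
  have hpw : (0:ℝ) < (1/2)^n := by positivity
  have e1 := hr.eventually (s.h.Del_close s.r _ hpw n)
  have e2 := hri.eventually (s.h.Del_close (-s.r) _ hpw n)
  have e3 := hQ.eventually_ge_atTop (4 ^ n * s.L * s.P.q)
  have e4 := hQ.eventually_ge_atTop (s.P.q / s.P.ε)
  obtain ⟨l, h1, h2, h3, h4, h5⟩ := (e1.and (e2.and (e3.and (e4.and (eventually_ge_atTop 1))))).exists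
  have hQl : 0 < Q l := by simp only [Q]; positivity
  have hQl' : (0:ℝ) < Q l := by exact_mod_cast hQl
  have c1 := cov_eventually s.h s.L s.hL (Q l) a (KK (n+1)) ((1/2)^n) ha (by unfold KK; positivity) hpw
  have hK : (0:ℝ) < KK (n+1) := by unfold KK; positivity
  have c2 : ∀ᶠ ε in 𝓝[>] (0:ℝ), ε ≤ min s.P.ε (min (1/8) ((1/2)^(n+2) / KK (n+1))) :=
    nhdsWithin_le_nhds (eventually_le_nhds (by positivity))
  obtain ⟨ε, k1, k2, k3⟩ := (c1.and (c2.and self_mem_nhdsWithin)).exists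
  have k3' : 0 < ε := k3
  rw [le_min_iff, le_min_iff, le_div_iff₀ hK] at k2
  have hη1 : ((1:ℝ)/2)^(n+6) < 1/2 := by
    have : ((1:ℝ)/2)^(n+6) ≤ (1/2)^6 := pow_le_pow_of_le_one (by norm_num) (by norm_num) (by omega)
    linarith [show ((1:ℝ)/2)^6 < 1/2 by norm_num]
  let P' : BP := ⟨Q l, ε, (1/2)^(n+6), hQl, k3, by linarith [k2.2.1], by positivity, hη1⟩
  have hcop : IsCoprime (s.p * (s.P.q * l) + 1) ((Q l : ℕ) : ℤ) := by
    have a1 : IsCoprime (s.p * (s.P.q * l) + 1) (s.P.q : ℤ) := ⟨1, -(s.p * l), by ring⟩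
    have a2 : IsCoprime (s.p * (s.P.q * l) + 1) (l : ℤ) := ⟨1, -(s.p * s.P.q), by ring⟩
    have : ((Q l : ℕ) : ℤ) = s.P.q * (s.P.q * l) := by simp [Q]
    rw [this]
    exact a1.mul_right (a1.mul_right a2)
  let s' : St := ⟨s.h.comp P'.g, P', s.p * (s.P.q * l) + 1, hcop⟩
  have hr' : s'.r = s.r + 1 / (Q l : ℝ) := by
    show ((s.p * (s.P.q * l) + 1 : ℤ) : ℝ) / (Q l : ℕ) = s.p / s.P.q + 1 / (Q l : ℝ)
    have hl : (0:ℝ) < l := by exact_mod_cast h5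
    simp only [Q]; push_cast; field_simp
  refine ⟨s', ⟨rfl, hr', rfl, k2.1, ?_, h3, ?_, ?_, ?_, k1⟩⟩
  · rw [mul_comm]; exact k2.2.2
  · rw [div_le_iff₀ hε] at h4
    rw [mul_comm]; exact h4
  · rw [hr']; exact h1
  · rw [hr']; exact h2

def P0 : BP := ⟨1, 1/8, 1/4, by norm_num, by norm_num, by norm_num, by norm_num, by norm_num⟩
def s0 : St := ⟨LD.one, P0, 0, ⟨0, 1, by simp [P0]⟩⟩

lemma exists_seq (a : ℝ) (ha : 1 < a) : ∃ s : ℕ → St, s 0 = s0 ∧ ∀ n, Step a n (s n) (s (n + 1)) := by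
  choose F hF using exists_step a ha
  exact ⟨fun n => Nat.rec s0 (fun n s => F n s) n, rfl, fun n => hF _ _⟩

/-- the constructed sequence -/
structure Sq (a : ℝ) where
  s : ℕ → St
  s_zero : s 0 = s0
  step : ∀ n, Step a n (s n) (s (n + 1))

namespace Sq
variable {a : ℝ} (S : Sq a)

/-- `n`-th approximating map, at (integer) time `i` -/
def F (n : ℕ) (i : ℤ) (z : Torus2) : Torus2 := (S.s n).h.conj (i * (S.s n).r) z

lemma conj_add (h : LD) (s t : ℝ) (z : Torus2) : h.conj s (h.conj t z) = h.conj (s + t) z := by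
  unfold LD.conj
  rw [Equiv.symm_apply_apply, Rt_add]

lemma conj_zero (h : LD) (z : Torus2) : h.conj 0 z = z := by
  unfold LD.conj
  have : Rt 0 (h.e.symm z) = h.e.symm z := by unfold Rt; simp
  rw [this, Equiv.apply_symm_apply]

lemma F_add (n : ℕ) (i j : ℤ) (z : Torus2) : S.F n i (S.F n j z) = S.F n (i + j) z := by
  unfold F
  rw [conj_add]; congr 1; push_cast; ring

lemma F_zero (n : ℕ) (z : Torus2) : S.F n 0 z = z := by
  unfold F
  rw [Int.cast_zero, zero_mul, conj_zero]

lemma F_iter (n : ℕ) (i : ℕ) (z : Torus2) : (S.F n 1)^[i] z = S.F n i z := by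
  induction i with
  | zero => simp [F_zero]
  | succ i ih =>
    rw [Function.iterate_succ_apply', ih, F_add]; congr 1; push_cast; ring

lemma F_succ (n : ℕ) (i : ℤ) (z : Torus2) : S.F (n+1) i z = (S.s n).h.conj (i * (S.s (n+1)).r) z := by
  unfold F LD.conj
  rw [(S.step n).h_eq]
  show (S.s n).h.e ((S.s (n+1)).P.g.e (Rt _ ((S.s (n+1)).P.g.e.symm ((S.s n).h.e.symm z)))) = _
  have : (i * (S.s (n+1)).r : ℝ) = ((i * (S.s (n+1)).p : ℤ) : ℝ) / (S.s (n+1)).P.q := by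
    unfold St.r; push_cast; ring
  rw [this, BP.g_comm, Equiv.apply_symm_apply]

lemma conj_dist (s : St) (u v : ℝ) (z : Torus2) : dist (s.h.conj u z) (s.h.conj v z) ≤ s.L * |u - v| := by
  unfold LD.conj
  refine (s.hL.dist_le_mul _ _).trans ?_
  gcongr
  exact Rt_dist _ _ _

lemma F_dist (n : ℕ) (i : ℤ) (z : Torus2) : dist (S.F n i z) (S.F (n+1) i z) ≤ (S.s n).L * (|(i:ℝ)| / (S.s (n+1)).P.q) := by
  rw [F_succ]
  refine (conj_dist (S.s n) _ _ z).trans (le_of_eq ?_)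
  have e : (i:ℝ) * (S.s n).r - i * (S.s (n+1)).r = -(i * (1 / ((S.s (n+1)).P.q : ℝ))) := by
    rw [(S.step n).r_eq]; ring
  rw [e, abs_neg, abs_mul, abs_of_nonneg (show (0:ℝ) ≤ 1 / ((S.s (n+1)).P.q : ℝ) by positivity), mul_one_div]

lemma q_pos (n : ℕ) : (0:ℝ) < (S.s n).P.q := by exact_mod_cast (S.s n).P.hq

lemma q_one_le (n : ℕ) : (1:ℝ) ≤ (S.s n).P.q := by exact_mod_cast (S.s n).P.hq

/-- time scale -/
def M (n : ℕ) : ℕ := 2 ^ n * (S.s n).P.q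

lemma q_mono (n : ℕ) : ((S.s n).P.q : ℝ) ≤ (S.s (n+1)).P.q := by
  have h1 := (S.step n).q_eps
  have h2 := (S.s n).P.hε'
  have h3 := S.q_pos (n+1)
  nlinarith

lemma F_dist' (n : ℕ) (i : ℤ) (hi : |(i:ℝ)| ≤ S.M n) (z : Torus2) : dist (S.F n i z) (S.F (n+1) i z) ≤ (1/2) ^ n := by
  refine (S.F_dist n i z).trans ?_
  have hq := S.q_pos (n+1)
  have h1 := (S.step n).q_big
  rw [← mul_div_assoc, div_le_iff₀ hq]
  have hM : (S.M n : ℝ) = 2 ^ n * (S.s n).P.q := by unfold M; push_cast; rfl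
  rw [hM] at hi
  calc ((S.s n).L : ℝ) * |(i:ℝ)| ≤ (S.s n).L * (2 ^ n * (S.s n).P.q) := by gcongr
    _ = (1/2) ^ n * (4 ^ n * (S.s n).L * (S.s n).P.q) := by
        rw [show (4:ℝ) ^ n = 2 ^ n * 2 ^ n by rw [← mul_pow]; norm_num]
        have : ((1:ℝ)/2) ^ n * 2 ^ n = 1 := by rw [← mul_pow]; norm_num
        linear_combination (-(S.s n).L * 2 ^ n * (S.s n).P.q : ℝ) * this
    _ ≤ (1/2) ^ n * (S.s (n+1)).P.q := by gcongr

lemma M_mono : Monotone S.M := by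
  refine monotone_nat_of_le_succ fun n => ?_
  have h : (S.s n).P.q ≤ (S.s (n+1)).P.q := by exact_mod_cast S.q_mono n
  unfold M
  exact Nat.mul_le_mul (Nat.pow_le_pow_right (by norm_num) (by omega)) h

lemma M_ge (n : ℕ) : 2 ^ n ≤ S.M n := Nat.le_mul_of_pos_right _ (S.s n).P.hq

end Sq

/-! ### Part 8: the limit diffeomorphism -/

lemma torusProj_cont : Continuous torusProj :=
  ((AddCircle.continuous_mk' (1:ℝ)).comp continuous_fst).prodMk ((AddCircle.continuous_mk' (1:ℝ)).comp continuous_snd)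

lemma lift_limit (D : ℕ → ℝ × ℝ → ℝ × ℝ) (hD : ∀ n, ContDiff ℝ (⊤ : ℕ∞) (D n))
    (hb : ∀ n, ∀ k ≤ n, ∀ p, ‖iteratedFDeriv ℝ k (D n) p‖ ≤ (1/2) ^ n)
    (hper : ∀ n p m, D n (p + zc m) = D n p)
    (f : ℕ → Torus2 → Torus2) (g : Torus2 → Torus2)
    (hf : ∀ n p, torusProj (p + ∑ j ∈ Finset.range n, D j p) = f n (torusProj p))
    (hg : ∀ z, Tendsto (fun n => f n z) atTop (𝓝 (g z))) :
    ContDiff ℝ (⊤ : ℕ∞) (fun p => p + ∑' n, D n p) ∧ IntEquivariant (fun p => p + ∑' n, D n p) ∧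
      IsLift (fun p => p + ∑' n, D n p) g := by
  have hsum : Summable (fun n : ℕ => ((1:ℝ)/2) ^ n) := summable_geometric_two
  refine ⟨?_, ?_, ?_⟩
  · refine contDiff_id.add (contDiff_tsum_of_eventually (v := fun _ n => (1/2)^n) hD (fun _ _ => hsum) ?_)
    intro k _
    rw [Nat.cofinite_eq_atTop]
    filter_upwards [eventually_ge_atTop k] with n hn x
    exact hb n k hn x
  · intro p m
    show (p + zc m) + ∑' n, D n (p + zc m) = (p + ∑' n, D n p) + zc m
    simp_rw [hper]; abel
  · intro p
    have h1 : Summable (fun n => D n p) := by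
      refine Summable.of_norm_bounded hsum fun n => ?_
      have := hb n 0 (Nat.zero_le _) p
      rwa [norm_iteratedFDeriv_zero] at this
    have h2 : Tendsto (fun n => torusProj (p + ∑ j ∈ Finset.range n, D j p)) atTop (𝓝 (torusProj (p + ∑' n, D n p))) :=
      (torusProj_cont.tendsto _).comp (tendsto_const_nhds.add h1.hasSum.tendsto_sum_nat)
    simp_rw [hf] at h2
    exact tendsto_nhds_unique h2 (hg _)

lemma LD.cont_symm (h : LD) : Continuous h.e.symm :=
  (Continuous.homeoOfEquivCompactToT2 (f := h.e) h.cont).symm.continuous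

lemma Rt_cont (t : ℝ) : Continuous (Rt t) := by
  unfold Rt; fun_prop

lemma LD.conj_cont (h : LD) (t : ℝ) : Continuous (h.conj t) :=
  h.cont.comp ((Rt_cont t).comp h.cont_symm)

lemma Rt_mp (t : ℝ) : MeasurePreserving (Rt t) volume volume := by
  have h1 : MeasurePreserving (fun x : UnitAddCircle => x + (t : UnitAddCircle)) volume volume :=
    measurePreserving_add_right _ _
  exact h1.prod (MeasurePreserving.id (volume : Measure UnitAddCircle))

lemma LD.conj_mp (h : LD) (t : ℝ) : MeasurePreserving (h.conj t) volume volume := by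
  have hs : MeasurePreserving h.e.symm volume volume :=
    MeasurePreserving.symm (Continuous.homeoOfEquivCompactToT2 (f := h.e) h.cont).toMeasurableEquiv h.mp
  exact h.mp.comp ((Rt_mp t).comp hs)

namespace Sq
variable {a : ℝ} (S : Sq a)

lemma exists_lim (i : ℤ) (z : Torus2) : ∃ w, Tendsto (fun n => S.F n i z) atTop (𝓝 w) := by
  apply cauchySeq_tendsto_of_complete
  obtain ⟨n0, hn0⟩ := exists_nat_ge |(i:ℝ)|
  rw [← cauchySeq_shift n0]
  refine cauchySeq_of_le_geometric (1/2) 1 (by norm_num) fun n => ?_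
  have h := S.F_dist' (n + n0) i (hn0.trans ?_) z
  · rw [show n + n0 + 1 = n + 1 + n0 by ring] at h
    refine h.trans ?_
    rw [one_mul]
    exact pow_le_pow_of_le_one (by norm_num) (by norm_num) (by omega)
  · have h1 := S.M_ge (n + n0)
    have h2 : n + n0 < 2 ^ (n + n0) := Nat.lt_two_pow_self
    exact_mod_cast (by omega : n0 ≤ S.M (n + n0))

/-- limit map at integer time `i` -/
def G (i : ℤ) (z : Torus2) : Torus2 := Classical.choose (S.exists_lim i z)

lemma G_tendsto (i : ℤ) (z : Torus2) : Tendsto (fun n => S.F n i z) atTop (𝓝 (S.G i z)) :=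
  Classical.choose_spec (S.exists_lim i z)

lemma G_dist (n : ℕ) (i : ℤ) (hi : |(i:ℝ)| ≤ S.M n) (z : Torus2) :
    dist (S.F n i z) (S.G i z) ≤ 2 * (1/2) ^ n := by
  have h : ∀ k, dist (S.F (k + n) i z) (S.F (k + 1 + n) i z) ≤ (2 * (1/2) ^ n) / 2 / 2 ^ k := by
    intro k
    have hm : (S.M n : ℝ) ≤ S.M (k + n) := by exact_mod_cast S.M_mono (by omega)
    have := S.F_dist' (k + n) i (hi.trans hm) z
    rw [show k + n + 1 = k + 1 + n by ring] at this
    refine this.trans (le_of_eq ?_)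
    rw [pow_add, div_eq_mul_inv _ ((2:ℝ)^k), ← inv_pow]
    norm_num; ring
  have := dist_le_of_le_geometric_two_of_tendsto₀ (f := fun k => S.F (k + n) i z) h
    ((tendsto_add_atTop_iff_nat (f := fun n => S.F n i z) n).2 (S.G_tendsto i z))
  simpa using this

lemma F_cont (n : ℕ) (i : ℤ) : Continuous (S.F n i) := (S.s n).h.conj_cont _

lemma M_eventually (i : ℤ) : ∀ᶠ n in atTop, |(i:ℝ)| ≤ S.M n := by
  obtain ⟨n0, hn0⟩ := exists_nat_ge |(i:ℝ)|
  filter_upwards [eventually_ge_atTop n0] with n hn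
  have h1 := S.M_ge n
  have h2 : n < 2 ^ n := Nat.lt_two_pow_self
  exact hn0.trans (by exact_mod_cast (by omega : n0 ≤ S.M n))

lemma G_unif (i : ℤ) : TendstoUniformly (fun n => S.F n i) (S.G i) atTop := by
  rw [Metric.tendstoUniformly_iff]
  intro ε hε
  have h1 : Tendsto (fun n : ℕ => 2 * ((1:ℝ)/2) ^ n) atTop (𝓝 0) := by
    have := (tendsto_pow_atTop_nhds_zero_of_lt_one (r := (1:ℝ)/2) (by norm_num) (by norm_num)).const_mul 2
    simpa using this
  filter_upwards [S.M_eventually i, h1.eventually_lt_const hε] with n hn h z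
  rw [dist_comm]
  exact (S.G_dist n i hn z).trans_lt h

lemma G_cont (i : ℤ) : Continuous (S.G i) :=
  (S.G_unif i).continuous (Frequently.of_forall fun n => S.F_cont n i)

lemma G_add (i j : ℤ) (z : Torus2) : S.G i (S.G j z) = S.G (i + j) z := by
  have h1 := (S.G_unif i).tendsto_comp (S.G_cont i).continuousAt (S.G_tendsto j z)
  simp_rw [F_add] at h1
  exact tendsto_nhds_unique h1 (S.G_tendsto _ z)

lemma G_zero (z : Torus2) : S.G 0 z = z := by
  have h := S.G_tendsto 0 z
  simp_rw [F_zero] at h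
  exact tendsto_nhds_unique h tendsto_const_nhds

/-- the limit map as a bijection -/
def T : Torus2 ≃ Torus2 where
  toFun := S.G 1
  invFun := S.G (-1)
  left_inv := fun z => by rw [G_add]; exact S.G_zero z
  right_inv := fun z => by rw [G_add]; exact S.G_zero z

lemma T_iter (i : ℕ) (z : Torus2) : S.T^[i] z = S.G i z := by
  induction i with
  | zero => exact (S.G_zero z).symm
  | succ i ih =>
    rw [Function.iterate_succ_apply', ih]
    show S.G 1 (S.G i z) = _
    rw [G_add]; congr 1; push_cast; ring

lemma F_base (i : ℤ) (z : Torus2) : S.F 0 i z = z := by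
  unfold F
  have : (S.s 0).r = 0 := by rw [S.s_zero]; simp [St.r, s0]
  rw [this, mul_zero, conj_zero]

lemma proj_sum (i : ℤ) (n : ℕ) (p : ℝ × ℝ) :
    torusProj (p + ∑ j ∈ Finset.range n, (S.s j).h.Del (i * (S.s j).r) (i * (S.s (j+1)).r) p) = S.F n i (torusProj p) := by
  induction n with
  | zero => simp [F_base]
  | succ n ih =>
    rw [Finset.sum_range_succ, ← add_assoc, F_succ]
    have hadd : ∀ u v : ℝ × ℝ, torusProj (u + v) = torusProj u + torusProj v := fun u v => rfl
    have hsub : ∀ u v : ℝ × ℝ, torusProj (u - v) = torusProj u - torusProj v := fun u v => rfl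
    rw [hadd, ih, LD.Del, hsub, (S.s n).h.Phi_lift, (S.s n).h.Phi_lift]
    unfold F
    abel

/-- candidate lift of `G i` -/
def tl (i : ℤ) (p : ℝ × ℝ) : ℝ × ℝ :=
  p + ∑' n, (S.s n).h.Del (i * (S.s n).r) (i * (S.s (n+1)).r) p

lemma lift_pos : ContDiff ℝ (⊤ : ℕ∞) (S.tl 1) ∧ IntEquivariant (S.tl 1) ∧ IsLift (S.tl 1) (S.G 1) :=
  lift_limit (fun n => (S.s n).h.Del ((1:ℤ) * (S.s n).r) ((1:ℤ) * (S.s (n+1)).r))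
    (fun n => LD.Del_contDiff _ _ _) (fun n => by simpa using (S.step n).sm)
    (fun n => LD.Del_per _ _ _) (fun n => S.F n 1) (S.G 1) (S.proj_sum 1) (S.G_tendsto 1)

lemma lift_neg : ContDiff ℝ (⊤ : ℕ∞) (S.tl (-1)) ∧ IntEquivariant (S.tl (-1)) ∧ IsLift (S.tl (-1)) (S.G (-1)) :=
  lift_limit (fun n => (S.s n).h.Del ((-1:ℤ) * (S.s n).r) ((-1:ℤ) * (S.s (n+1)).r))
    (fun n => LD.Del_contDiff _ _ _) (fun n => by simpa using (S.step n).smi)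
    (fun n => LD.Del_per _ _ _) (fun n => S.F n (-1)) (S.G (-1)) (S.proj_sum (-1)) (S.G_tendsto (-1))

lemma G_mp (i : ℤ) : MeasurePreserving (S.G i) volume volume := by
  refine ⟨(S.G_cont i).measurable, ?_⟩
  have : IsProbabilityMeasure (Measure.map (S.G i) (volume : Measure Torus2)) :=
    Measure.isProbabilityMeasure_map (S.G_cont i).measurable.aemeasurable
  refine ext_of_forall_integral_eq_of_IsFiniteMeasure fun f => ?_
  rw [integral_map (S.G_cont i).measurable.aemeasurable f.continuous.aestronglyMeasurable]
  have h1 : Tendsto (fun n => ∫ x, f (S.F n i x)) atTop (𝓝 (∫ x, f (S.G i x))) := by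
    refine tendsto_integral_of_dominated_convergence (fun _ => ‖f‖) (fun n => ?_) (integrable_const _) (fun n => ?_) ?_
    · exact (f.continuous.comp (S.F_cont n i)).aestronglyMeasurable
    · exact Eventually.of_forall fun x => f.norm_coe_le_norm _
    · exact Eventually.of_forall fun x => (f.continuous.tendsto _).comp (S.G_tendsto i x)
  have h2 : ∀ n, ∫ x, f (S.F n i x) = ∫ x, f x := by
    intro n
    have hm : MeasurePreserving (S.F n i) volume volume := (S.s n).h.conj_mp _
    have := integral_map (μ := (volume : Measure Torus2)) hm.measurable.aemeasurable (f.continuous.aestronglyMeasurable (μ := Measure.map (S.F n i) volume))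
    rw [hm.map_eq] at this
    exact this.symm
  simp_rw [h2] at h1
  exact tendsto_nhds_unique h1 tendsto_const_nhds

def D : SmoothMPTorusDiffeo where
  toEquiv := S.T
  lift := S.tl 1
  liftInv := S.tl (-1)
  lift_contDiff := S.lift_pos.1
  liftInv_contDiff := S.lift_neg.1
  lift_equivariant := S.lift_pos.2.1
  liftInv_equivariant := S.lift_neg.2.1
  lift_isLift := S.lift_pos.2.2
  liftInv_isLift := S.lift_neg.2.2
  measurePreserving := S.G_mp 1

end Sq

/-! ### Part 9: generic points -/

/-- Lipschitz functions form a subalgebra -/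
def lipAlg : Subalgebra ℝ C(Torus2, ℝ) where
  carrier := {f | ∃ K, LipschitzWith K f}
  mul_mem' := by
    rintro f g ⟨K, hK⟩ ⟨K', hK'⟩
    refine ⟨‖f‖₊ * K' + ‖g‖₊ * K, LipschitzWith.of_dist_le_mul fun x y => ?_⟩
    have h1 := hK.dist_le_mul x y
    have h2 := hK'.dist_le_mul x y
    rw [Real.dist_eq] at *
    have e : (f * g) x - (f * g) y = f x * (g x - g y) + g y * (f x - f y) := by
      simp only [ContinuousMap.mul_apply]; ring
    rw [e]
    refine (abs_add_le _ _).trans ?_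
    rw [abs_mul, abs_mul]
    have h3 : |f x| ≤ ‖f‖ := f.norm_coe_le_norm x
    have h4 : |g y| ≤ ‖g‖ := g.norm_coe_le_norm y
    push_cast
    calc _ ≤ ‖f‖ * (K' * dist x y) + ‖g‖ * (K * dist x y) := by gcongr
      _ = _ := by ring
  add_mem' := by
    rintro f g ⟨K, hK⟩ ⟨K', hK'⟩
    exact ⟨K + K', hK.add hK'⟩
  algebraMap_mem' := fun r => ⟨0, LipschitzWith.const _⟩

lemma lip_dense (f : C(Torus2, ℝ)) (ε : ℝ) (hε : 0 < ε) :
    ∃ g : C(Torus2, ℝ), (∃ K, LipschitzWith K g) ∧ ‖g - f‖ < ε := by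
  obtain ⟨⟨g, hg⟩, h⟩ := ContinuousMap.exists_mem_subalgebra_near_continuousMap_of_separatesPoints lipAlg (by
    intro x y hxy
    refine ⟨fun z => dist x z, ⟨⟨fun z => dist x z, by fun_prop⟩, ⟨1, LipschitzWith.dist_right x⟩, rfl⟩, ?_⟩
    simpa using hxy) f ε hε
  exact ⟨g, hg, h⟩

/-- Birkhoff average -/
def av (T : Torus2 → Torus2) (z : Torus2) (f : Torus2 → ℝ) (N : ℕ) : ℝ :=
  (N : ℝ)⁻¹ * ∑ i ∈ Finset.range N, f (T^[i] z)

lemma av_close (T : Torus2 → Torus2) (z : Torus2) (f g : Torus2 → ℝ) (ε : ℝ) (hε : 0 ≤ ε) (h : ∀ x, |f x - g x| ≤ ε) (N : ℕ) :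
    |av T z f N - av T z g N| ≤ ε := by
  unfold av
  rw [← mul_sub, ← Finset.sum_sub_distrib, abs_mul, abs_of_nonneg (by positivity)]
  rcases Nat.eq_zero_or_pos N with rfl | hN
  · simpa using hε
  have hN' : (0:ℝ) < N := by exact_mod_cast hN
  rw [inv_mul_le_iff₀ hN']
  refine (Finset.abs_sum_le_sum_abs _ _).trans ?_
  refine (Finset.sum_le_sum fun i _ => h _).trans ?_
  simp

lemma generic_of_lip (T : Torus2 → Torus2) (z : Torus2)
    (h : ∀ f : Torus2 → ℝ, LipschitzWith 1 f → (∀ x, |f x| ≤ 1) → Tendsto (av T z f) atTop (𝓝 (∫ y, f y))) :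
    IsGenericPt T volume z := by
  have h2 : ∀ f : C(Torus2, ℝ), (∃ K, LipschitzWith K f) → Tendsto (av T z f) atTop (𝓝 (∫ y, f y)) := by
    rintro f ⟨K, hK⟩
    set c : ℝ := K + ‖f‖ + 1 with hc
    have hc0 : 0 < c := by positivity
    have := h (fun x => c⁻¹ * f x) (LipschitzWith.of_dist_le_mul fun x y => by
        rw [Real.dist_eq, ← mul_sub, abs_mul, abs_of_pos (inv_pos.2 hc0), inv_mul_le_iff₀ hc0]
        have h1 := hK.dist_le_mul x y
        rw [Real.dist_eq] at h1
        refine h1.trans ?_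
        rw [NNReal.coe_one, one_mul]
        gcongr
        rw [hc]; linarith [norm_nonneg f]) (fun x => by
        rw [abs_mul, abs_of_pos (inv_pos.2 hc0), inv_mul_le_iff₀ hc0]
        have h3 : |f x| ≤ ‖f‖ := f.norm_coe_le_norm x
        rw [hc]; have := K.2; simp only [NNReal.val_eq_coe] at this; linarith)
    have h4 := this.const_mul c
    rw [integral_const_mul, ← mul_assoc, mul_inv_cancel₀ hc0.ne', one_mul] at h4
    refine h4.congr fun N => ?_
    unfold av
    rw [← Finset.mul_sum]
    field_simp
  intro f
  rw [Metric.tendsto_nhds]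
  intro ε hε
  obtain ⟨g, hg, hgf⟩ := lip_dense f (ε/4) (by positivity)
  have hcl : ∀ x, |f x - g x| ≤ ε/4 := fun x => by
    have := (g - f).norm_coe_le_norm x
    rw [ContinuousMap.sub_apply, Real.norm_eq_abs, abs_sub_comm] at this
    linarith
  have hint : |(∫ x, f x) - ∫ x, g x| ≤ ε/4 := by
    rw [← integral_sub (integrable_of_cont _ _ f.continuous) (integrable_of_cont _ _ g.continuous)]
    have := norm_integral_le_of_norm_le_const (μ := (volume : Measure Torus2)) (C := ε/4)
      (f := fun x => f x - g x) (Eventually.of_forall fun x => hcl _)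
    simpa using this
  have := (Metric.tendsto_nhds.1 (h2 g hg)) (ε/4) (by positivity)
  filter_upwards [this] with N hN
  have h5 := av_close T z f g (ε/4) (by positivity) hcl N
  change dist (av T z f N) _ < ε
  rw [Real.dist_eq] at *
  rw [abs_le] at *
  rw [abs_lt] at *
  constructor <;> linarith [h5.1, h5.2, hN.1, hN.2, hint.1, hint.2]

namespace Sq
variable {a : ℝ} (S : Sq a)

/-- the bad strip at level `n` -/
def W (n : ℕ) : Set Torus2 := {z | ‖((S.s n).h.e.symm z).2‖ ≤ KK n * (S.s n).P.ε}

lemma L_q (n : ℕ) : ((S.s n).L : ℝ) * ((S.s n).P.q * (1 / (S.s (n+1)).P.q)) ≤ (1/2) ^ n := by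
  have h := (S.step n).q_big
  have hq := S.q_pos (n+1)
  have h2 : ((S.s n).L : ℝ) * (S.s n).P.q ≤ (1/4)^n * (S.s (n+1)).P.q := by
    have e : ((1:ℝ)/4)^n * 4^n = 1 := by rw [← mul_pow]; norm_num
    calc ((S.s n).L : ℝ) * (S.s n).P.q = (1/4)^n * (4 ^ n * (S.s n).L * (S.s n).P.q) := by
          linear_combination (-((S.s n).L : ℝ) * (S.s n).P.q) * e
      _ ≤ _ := by gcongr
  have h3 : ((1:ℝ)/4)^n ≤ (1/2)^n := pow_le_pow_left₀ (by norm_num) (by norm_num) n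
  rw [← mul_assoc, mul_one_div, div_le_iff₀ hq]
  exact h2.trans (by gcongr)

lemma L_q' (n : ℕ) : ((S.s n).L : ℝ) / (S.s (n+1)).P.q ≤ (1/2) ^ n := by
  refine le_trans ?_ (S.L_q n)
  have hq := S.q_pos (n+1)
  have h1 := S.q_one_le n
  rw [div_eq_mul_one_div]
  have : (0:ℝ) ≤ (S.s n).L := NNReal.coe_nonneg _
  gcongr
  have h0 : (0:ℝ) ≤ 1 / ((S.s (n+1)).P.q : ℝ) := by positivity
  nlinarith

lemma KK_ge (n : ℕ) : 16 ≤ KK n := by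
  unfold KK
  have : (1:ℝ) ≤ 2 ^ n := one_le_pow₀ (by norm_num)
  linarith

lemma gen_bound (n : ℕ) (z : Torus2) (h1 : z ∉ S.W (n+1)) (h2 : z ∉ S.W (n+2)) (f : Torus2 → ℝ)
    (hf : LipschitzWith 1 f) (hf1 : ∀ z, |f z| ≤ 1) (N : ℕ) (hN1 : S.M (n+2) ≤ N) (hN2 : N ≤ S.M (n+3)) :
    |∑ i ∈ Finset.range N, f (S.T^[i] z) - N * ∫ y, f y| ≤ N * (8 * (1/2) ^ n) := by
  simp only [W, Set.mem_ofPred_eq, not_le] at h1 h2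
  set w := (S.s (n+2)).h.e.symm z with hw
  have st1 := S.step n
  have st2 := S.step (n+1)
  have st3 := S.step (n+2)
  have hgw : (S.s (n+2)).P.g.e w = (S.s (n+1)).h.e.symm z := by
    rw [hw, st2.h_eq, Equiv.eq_symm_apply]
    show ((S.s (n+1)).h.comp (S.s (n+2)).P.g).e _ = z
    rw [Equiv.apply_symm_apply]
  have hp2 : (0:ℝ) < (1/2)^n := by positivity
  have k1 := KK_ge (n+1)
  have k2 := KK_ge (n+2)
  have hε1 := (S.s (n+1)).P.hε
  have hε2 := (S.s (n+2)).P.hε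
  have hpow2 : ((1:ℝ)/2)^(n+2) ≤ (1/2)^n := pow_le_pow_of_le_one (by norm_num) (by norm_num) (by omega)
  have hpow22 : ((1:ℝ)/2)^(n+2) ≤ (1/2)^1 := pow_le_pow_of_le_one (by norm_num) (by norm_num) (by omega)
  have hpow1 : ((1:ℝ)/2)^(n+1) ≤ (1/2)^n := pow_le_pow_of_le_one (by norm_num) (by norm_num) (by omega)
  have G := generic_avg (S.s (n+1)).h (S.s (n+1)).L (S.s (n+2)).L (S.s (n+1)).hL (S.s (n+2)).P
    (by rw [← st2.h_eq]; exact (S.s (n+2)).hL) f hf hf1 (S.s (n+2)).p (S.s (n+2)).hp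
    (1 / (S.s (n+3)).P.q) (by have := S.q_pos (n+3); positivity) w N (∫ y, f y) (int_bd f hf1)
    (S.s (n+1)).P.ε ((S.s n).L / (S.s (n+1)).P.q + 12 * (S.s (n+1)).P.ε) (KK (n+1)) st2.ε_le (by positivity)
    (by linarith) (by have := st1.ε_K; linarith)
    (by
      have := st3.q_eps
      have h3 := st2.ε_le
      rw [mul_one_div, div_le_iff₀ (S.q_pos (n+3))]
      refine this.trans ?_
      gcongr)
    (fun c hc => by
      have := good_level (S.s n).h (S.s n).L (S.s n).hL f hf hf1 (S.s (n+1)).P c (by linarith)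
      rwa [← st1.h_eq] at this)
    (by nlinarith) (by rw [hgw]; exact h1.le)
  rw [← st2.h_eq] at G
  have hr : ((S.s (n+2)).p / (S.s (n+2)).P.q + 1 / (S.s (n+3)).P.q : ℝ) = (S.s (n+3)).r := st3.r_eq.symm
  rw [hr] at G
  have e : ∀ i : ℕ, (S.s (n+2)).h.e (Rt (i * (S.s (n+3)).r) w) = S.F (n+3) i z := by
    intro i
    rw [S.F_succ (n+2) i z]
    simp [LD.conj, hw]
  simp_rw [e] at G
  have hcl : |∑ i ∈ Finset.range N, f (S.T^[i] z) - ∑ i ∈ Finset.range N, f (S.F (n+3) i z)| ≤ N * (1/2)^n := by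
    rw [← Finset.sum_sub_distrib]
    refine (Finset.abs_sum_le_sum_abs _ _).trans ?_
    refine (Finset.sum_le_sum (g := fun _ => ((1:ℝ)/2)^n) fun i hi => ?_).trans (by simp)
    have hi' : i ≤ S.M (n+3) := (Finset.mem_range.1 hi).le.trans hN2
    have d := S.G_dist (n+3) i (by rw [Int.cast_natCast, abs_of_nonneg (by positivity)]; exact_mod_cast hi') z
    have l := hf.dist_le_mul (S.F (n+3) i z) (S.G i z)
    rw [NNReal.coe_one, one_mul, Real.dist_eq, abs_sub_comm] at l
    rw [T_iter]
    refine l.trans (d.trans ?_)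
    rw [show n + 3 = (n + 2) + 1 by ring, pow_succ]
    linarith
  have b1 := S.L_q (n+2)
  have b2 := S.L_q' (n+1)
  have b3 := S.L_q' n
  have b4 : 12 * (S.s (n+1)).P.ε ≤ (1/2)^n := by
    have := st1.ε_K
    nlinarith
  have b5 : 22 / (KK (n+1) - 5) = (1/2)^n := by
    unfold KK
    rw [pow_succ]
    have : (2:ℝ)^n ≠ 0 := by positivity
    have e : (2:ℝ)^n * (1/2)^n = 1 := by rw [← mul_pow]; norm_num
    rw [div_eq_iff (by simp)]
    linear_combination (-22 : ℝ) * e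
  have b6 : 2 * ((S.s (n+2)).P.q : ℝ) ≤ N * (1/2)^n := by
    have hM : (S.M (n+2) : ℝ) = 2 ^ (n+2) * (S.s (n+2)).P.q := by unfold M; push_cast; rfl
    have hN' : (S.M (n+2) : ℝ) ≤ N := by exact_mod_cast hN1
    rw [hM] at hN'
    have e : (2:ℝ)^n * (1/2)^n = 1 := by rw [← mul_pow]; norm_num
    calc 2 * ((S.s (n+2)).P.q : ℝ) ≤ 4 * (S.s (n+2)).P.q := by linarith [S.q_pos (n+2)]
      _ = (2 ^ (n+2) * (S.s (n+2)).P.q) * (1/2)^n := by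
          rw [pow_add]; linear_combination (-4 * (S.s (n+2)).P.q : ℝ) * e
      _ ≤ _ := by gcongr
  rw [b5] at G
  have hfin : 2 * ((S.s (n+2)).P.q : ℝ) + N * ((S.s (n+2)).L * ((S.s (n+2)).P.q * (1 / (S.s (n+3)).P.q)) + (S.s (n+1)).L / (S.s (n+2)).P.q + ((S.s n).L / (S.s (n+1)).P.q + 12 * (S.s (n+1)).P.ε) + (1/2)^n) ≤ N * (1/2)^n + N * (6 * (1/2)^n) := by
    gcongr
    change ((S.s (n+2)).L : ℝ) * ((S.s (n+2)).P.q * (1 / (S.s (n+3)).P.q)) ≤ _ at b1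
    change ((S.s (n+1)).L : ℝ) / (S.s (n+2)).P.q ≤ _ at b2
    linarith
  have G2 := G.trans hfin
  rw [abs_le] at G2 hcl ⊢
  constructor <;> linarith [G2.1, G2.2, hcl.1, hcl.2]

lemma exists_scale (n0 N : ℕ) (hN : S.M n0 ≤ N) : ∃ n ≥ n0, S.M n ≤ N ∧ N ≤ S.M (n+1) := by
  classical
  have hex : ∃ m, N < S.M m := ⟨N, (Nat.lt_two_pow_self).trans_le (S.M_ge N)⟩
  have h1 := Nat.find_spec hex
  have h0 : n0 < Nat.find hex := by
    by_contra hc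
    exact absurd (S.M_mono (not_lt.1 hc)) (by omega)
  refine ⟨Nat.find hex - 1, by omega, ?_, ?_⟩
  · exact not_lt.1 (Nat.find_min hex (by omega))
  · rw [Nat.sub_add_cancel (by omega)]; exact h1.le

lemma generic_of_good (z : Torus2) (n0 : ℕ) (h : ∀ n ≥ n0, z ∉ S.W n) : IsGenericPt S.T volume z := by
  refine generic_of_lip _ _ fun f hf hf1 => ?_
  rw [Metric.tendsto_nhds]
  intro ε hε
  have h1 : Tendsto (fun n : ℕ => 8 * ((1:ℝ)/2) ^ n) atTop (𝓝 0) := by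
    have := (tendsto_pow_atTop_nhds_zero_of_lt_one (r := (1:ℝ)/2) (by norm_num) (by norm_num)).const_mul 8
    simpa using this
  obtain ⟨n1, hn1⟩ := eventually_atTop.1 (h1.eventually_lt_const hε)
  filter_upwards [eventually_ge_atTop (S.M (n0 + n1 + 2))] with N hN
  obtain ⟨m, hm, hm1, hm2⟩ := S.exists_scale _ N hN
  obtain ⟨n, rfl⟩ : ∃ n, m = n + 2 := ⟨m - 2, by omega⟩
  have b := S.gen_bound n z (h _ (by omega)) (h _ (by omega)) f hf hf1 N hm1 hm2
  have hNpos : (0:ℝ) < N := by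
    have := S.M_ge (n+2)
    have h2 : 0 < 2 ^ (n+2) := by positivity
    exact_mod_cast (by omega : 0 < N)
  rw [Real.dist_eq]
  have e : av S.T z f N - ∫ y, f y = (N:ℝ)⁻¹ * (∑ i ∈ Finset.range N, f (S.T^[i] z) - N * ∫ y, f y) := by
    unfold av; field_simp
  rw [e, abs_mul, abs_of_pos (inv_pos.2 hNpos)]
  refine lt_of_le_of_lt ?_ (hn1 n (by omega))
  rw [inv_mul_le_iff₀ hNpos]
  exact b

end Sq

/-! ### Part 10: nongeneric points and conclusion -/

namespace Sq
variable {a : ℝ} (S : Sq a)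

/-- nongeneric points -/
def NB : Set Torus2 := {x | ¬ IsGenericPt S.T volume x}

lemma NB_sub (n : ℕ) : S.NB ⊆ ⋃ m, S.W (n + m + 1) := by
  intro z hz
  by_contra hc
  refine hz (S.generic_of_good z (n+1) fun m hm hzm => hc ?_)
  rw [Set.mem_iUnion]
  refine ⟨m - (n+1), ?_⟩
  rwa [show n + (m - (n+1)) + 1 = m by omega]

lemma W_cov (n : ℕ) : Cov a ((1/2)^n) (S.W (n+1)) := by
  refine (S.step n).cov.mono fun z hz => ?_
  refine ⟨(S.s n).h.e.symm z, ?_, Equiv.apply_symm_apply _ _⟩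
  have hgw : (S.s (n+1)).P.g.e ((S.s (n+1)).h.e.symm z) = (S.s n).h.e.symm z := by
    rw [(S.step n).h_eq, Equiv.eq_symm_apply]
    show ((S.s n).h.comp (S.s (n+1)).P.g).e _ = z
    rw [Equiv.apply_symm_apply]
  have := (S.s (n+1)).P.g_strip ((S.s (n+1)).h.e.symm z) _ hz
  rw [hgw] at this
  rcases this with h | h
  · left
    refine h.trans (le_of_eq ?_)
    ring
  · right; exact h

lemma dim_le (ha : 1 < a) : dimH S.NB ≤ ENNReal.ofReal a :=
  dimH_limsup_le a (by linarith) S.NB (fun n => S.W (n+1)) S.W_cov S.NB_sub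

lemma W_vol (n : ℕ) : volume (S.W (n+1)) ≤ ENNReal.ofReal ((1/2)^n) := by
  refine (strip_vol (S.s (n+1)).h _).trans (ENNReal.ofReal_le_ofReal ?_)
  have := (S.step n).ε_K
  rw [show n + 2 = n + 1 + 1 by ring, pow_succ, pow_succ] at this
  have h : (0:ℝ) < (1/2)^n := by positivity
  linarith

lemma NB_vol : volume S.NB = 0 := by
  have hs : ∑' n, volume (S.W (n+1)) ≠ ∞ := by
    refine ne_top_of_le_ne_top ?_ (ENNReal.tsum_le_tsum S.W_vol)
    rw [← ENNReal.ofReal_tsum_of_nonneg (fun n => by positivity) summable_geometric_two]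
    exact ENNReal.ofReal_ne_top
  have := ae_eventually_notMem hs
  refine measure_mono_null ?_ (ae_iff.1 this)
  intro z hz hc
  obtain ⟨n0, hn0⟩ := eventually_atTop.1 hc
  refine hz (S.generic_of_good z (n0+1) fun n hn => ?_)
  have := hn0 (n-1) (by omega)
  rwa [Nat.sub_add_cancel (by omega)] at this

lemma ergodic : IsErgodicWrt S.T volume := by
  intro E hE hTE
  have hgen : ∀ᵐ z, IsGenericPt S.T volume z := ae_iff.2 S.NB_vol
  have hTc : Continuous S.T := S.G_cont 1
  have hTm : MeasurePreserving S.T volume volume := S.G_mp 1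
  have key : ∀ f : C(Torus2, ℝ), ∫ x in E, f x = (volume E).toReal * ∫ x, f x := by
    intro f
    have hinv : ∀ i : ℕ, ∫ x in E, f (S.T^[i] x) = ∫ x in E, f x := by
      intro i
      have hm := hTm.iterate i
      have hEi : S.T^[i] ⁻¹' E = E := by
        induction i with
        | zero => rfl
        | succ i ih => rw [Function.iterate_succ', Set.preimage_comp, hTE, ih (hTm.iterate i)]
      have hr := hm.restrict_preimage hE
      rw [hEi] at hr
      have := integral_map (μ := (volume : Measure Torus2).restrict E) hr.measurable.aemeasurable
        (f.continuous.aestronglyMeasurable (μ := Measure.map (S.T^[i]) (volume.restrict E)))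
      rw [hr.map_eq] at this
      exact this.symm
    have h1 : Tendsto (fun N => ∫ x in E, av S.T x f N) atTop (𝓝 (∫ x in E, (∫ y, f y))) := by
      refine tendsto_integral_of_dominated_convergence (fun _ => ‖f‖) (fun N => ?_) (integrable_const _) (fun N => ?_) ?_
      · refine Continuous.aestronglyMeasurable ?_
        unfold av
        refine continuous_const.mul (continuous_finsetSum _ fun i _ => f.continuous.comp (hTc.iterate i))
      · refine Eventually.of_forall fun x => ?_
        have := av_close S.T x f (fun _ => 0) ‖f‖ (norm_nonneg _) (fun x => by
          rw [sub_zero]; exact f.norm_coe_le_norm x) N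
        simpa [av] using this
      · filter_upwards [ae_restrict_of_ae hgen] with x hx
        exact hx f
    have h2 : ∀ᶠ N : ℕ in atTop, ∫ x in E, av S.T x f N = ∫ x in E, f x := by
      filter_upwards [eventually_gt_atTop 0] with N hN
      unfold av
      rw [integral_const_mul, integral_finsetSum]
      · simp_rw [hinv]
        have : (N:ℝ) ≠ 0 := by exact_mod_cast hN.ne'
        simp [this]
      · intro i _
        exact (integrable_of_cont volume _ (f.continuous.comp (hTc.iterate i))).integrableOn
    have h3 := tendsto_nhds_unique (h1.congr' h2) tendsto_const_nhds
    rw [← h3]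
    simp [Measure.real]
  have hμ : (volume : Measure Torus2).restrict E = (volume E) • (volume : Measure Torus2) := by
    have : IsFiniteMeasure ((volume E) • (volume : Measure Torus2)) :=
      Measure.smul_finite _ (measure_ne_top _ _)
    refine ext_of_forall_integral_eq_of_IsFiniteMeasure fun f => ?_
    rw [integral_smul_measure]
    exact key f.toContinuousMap
  have h0 : volume E * volume Eᶜ = 0 := by
    have := congrArg (fun m : Measure Torus2 => m Eᶜ) hμ
    simp only [Measure.smul_apply, smul_eq_mul] at this
    rw [← this, Measure.restrict_apply hE.compl]
    simp
  rcases mul_eq_zero.1 h0 with h | h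
  · exact Or.inl h
  · right
    have := prob_compl_eq_zero_iff (μ := (volume : Measure Torus2)) hE
    exact this.1 h

/-- the set of abscissas of fixed-level points -/
def Z : Set UnitAddCircle := {x | ∀ j, (S.s (j+1)).P.η ≤ ‖(S.s (j+1)).P.q • x - ((1/2 : ℝ) : UnitAddCircle)‖}

lemma Z_fix (x : UnitAddCircle) (hx : x ∈ S.Z) (n : ℕ) : (S.s n).h.e (x, 0) = (x, 0) := by
  induction n with
  | zero => rw [S.s_zero]; rfl
  | succ n ih =>
    rw [(S.step n).h_eq, LD.comp_e, (S.s (n+1)).P.g_fix x (hx n), ih]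

lemma Z_meas : MeasurableSet S.Z := by
  have : IsClosed S.Z := by
    unfold Z
    rw [Set.ofPred_forall]
    refine isClosed_iInter fun j => isClosed_le continuous_const ?_
    fun_prop
  exact this.measurableSet

lemma Z_vol : volume S.Zᶜ ≤ ENNReal.ofReal (1/16) := by
  have hsub : S.Zᶜ ⊆ ⋃ j, {x | ‖(S.s (j+1)).P.q • x + -((1/2 : ℝ) : UnitAddCircle)‖ ≤ (S.s (j+1)).P.η} := by
    intro x hx
    by_contra hc
    refine hx fun j => ?_
    by_contra hj
    refine hc (Set.mem_iUnion.2 ⟨j, ?_⟩)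
    show ‖_ + -_‖ ≤ _
    rw [← sub_eq_add_neg]
    exact (not_le.1 hj).le
  refine (measure_mono hsub).trans ((measure_iUnion_le _).trans ?_)
  have h1 : ∀ j, volume {x : UnitAddCircle | ‖(S.s (j+1)).P.q • x + -((1/2 : ℝ) : UnitAddCircle)‖ ≤ (S.s (j+1)).P.η} ≤ ENNReal.ofReal ((1/32) * (1/2)^j) := by
    intro j
    have hm := mp_nsmul_add (S.s (j+1)).P.q (S.s (j+1)).P.hq (-((1/2 : ℝ) : UnitAddCircle))
    have hms : MeasurableSet {x : UnitAddCircle | ‖x‖ ≤ (S.s (j+1)).P.η} :=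
      (isClosed_le continuous_norm continuous_const).measurableSet
    have := hm.measure_preimage hms.nullMeasurableSet
    change volume {x : UnitAddCircle | ‖(S.s (j+1)).P.q • x + -((1/2 : ℝ) : UnitAddCircle)‖ ≤ (S.s (j+1)).P.η} = _ at this
    rw [this]
    refine (vol_strip _).trans (ENNReal.ofReal_le_ofReal (le_of_eq ?_))
    rw [(S.step j).η_eq, pow_add]; norm_num; ring
  refine (ENNReal.tsum_le_tsum h1).trans ?_
  rw [← ENNReal.ofReal_tsum_of_nonneg (fun n => by positivity) (summable_geometric_two.mul_left _), tsum_mul_left, tsum_geometric_two]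
  norm_num

/-- test function -/
def tf (z : Torus2) : ℝ := ‖z.2‖

lemma tf_lip : LipschitzWith 1 tf := lipschitzWith_one_norm.comp LipschitzWith.prod_snd |>.weaken (by norm_num)

lemma norm_half (x : UnitAddCircle) : ‖x‖ ≤ 1/2 := by
  have := AddCircle.norm_le_half_period (p := (1:ℝ)) (x := x) one_ne_zero
  simpa using this

lemma tf_int : 3/32 ≤ ∫ z, tf z := by
  have hms : MeasurableSet {z : Torus2 | ‖z.2‖ ≤ 1/8} :=
    (isClosed_le (by fun_prop) continuous_const).measurableSet
  have hv : volume {z : Torus2 | ‖z.2‖ ≤ 1/8} ≤ ENNReal.ofReal (1/4) := by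
    have := strip_vol LD.one (1/8)
    norm_num at this
    norm_num
    exact this
  have hv' : (volume : Measure Torus2).real {z : Torus2 | ‖z.2‖ ≤ 1/8} ≤ 1/4 :=
    ENNReal.toReal_le_of_le_ofReal (by norm_num) hv
  have h1 : ∫ z, ({z : Torus2 | ‖z.2‖ ≤ 1/8}ᶜ).indicator (fun _ => (1/8 : ℝ)) z ≤ ∫ z, tf z := by
    refine integral_mono ((integrable_const _).indicator hms.compl) (integrable_of_cont _ _ tf_lip.continuous) fun z => ?_
    refine Set.indicator_le' (fun z hz => ?_) (fun z _ => norm_nonneg _) z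
    have hz' : ¬ ‖z.2‖ ≤ 1/8 := hz
    exact (not_le.1 hz').le
  rw [integral_indicator_const _ hms.compl, probReal_compl_eq_one_sub hms, smul_eq_mul] at h1
  linarith

lemma Psi_small (n : ℕ) : Psi (S.s n).h tf 0 ≤ 1/32 := by
  have hv' : (volume : Measure UnitAddCircle).real S.Zᶜ ≤ 1/16 :=
    ENNReal.toReal_le_of_le_ofReal (by norm_num) S.Z_vol
  have h1 : Psi (S.s n).h tf 0 ≤ ∫ x, (S.Zᶜ).indicator (fun _ => (1/2 : ℝ)) x := by
    unfold Psi
    refine integral_mono (integrable_of_cont _ _ ?_) ((integrable_const _).indicator S.Z_meas.compl) fun x => ?_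
    · exact tf_lip.continuous.comp ((S.s n).h.cont.comp (by fun_prop))
    · by_cases hx : x ∈ S.Z
      · have : x ∉ S.Zᶜ := fun h => h hx
        show tf ((S.s n).h.e (x, 0)) ≤ _
        rw [Set.indicator_of_notMem this, S.Z_fix x hx]
        simp [tf]
      · show _ ≤ (S.Zᶜ).indicator _ x
        rw [Set.indicator_of_mem (show x ∈ S.Zᶜ from hx)]
        exact norm_half _
  rw [integral_indicator_const _ S.Z_meas.compl, smul_eq_mul] at h1
  linarith

lemma q_ge (n : ℕ) : n ≤ (S.s n).P.q := by
  have : ((n:ℝ) + 1) ≤ (S.s n).P.q := by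
    induction n with
    | zero => simpa using S.q_one_le 0
    | succ n ih =>
      have h1 := (S.step n).q_eps
      have h2 := (S.s n).P.hε'
      have h3 := S.q_pos (n+1)
      push_cast
      nlinarith
  exact_mod_cast (by linarith : (n:ℝ) ≤ (S.s n).P.q)

lemma av_small (x : UnitAddCircle) (hx : x ∈ S.Z) (n : ℕ) :
    av S.T (x, 0) tf (S.s (n+1)).P.q ≤ 1/32 + 2 * (1/2)^n := by
  set q := (S.s (n+1)).P.q with hq
  have hq0 : 0 < q := (S.s (n+1)).P.hq
  have hq0' : (0:ℝ) < q := by exact_mod_cast hq0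
  have hinv : (S.s n).h.e.symm (x, 0) = (x, 0) := by
    rw [Equiv.symm_apply_eq, S.Z_fix x hx]
  have hF : ∀ i : ℕ, S.F (n+1) i (x, 0) = (S.s n).h.e (Rt (i * (S.s (n+1)).r) (x, 0)) := by
    intro i
    rw [F_succ, LD.conj, hinv]; simp
  have hp := perm_sum (S.s (n+1)).p q hq0 (S.s (n+1)).hp (fun t => tf ((S.s n).h.e (x + t, 0))) 0
  have hs := shift_avg (S.s n).h (S.s n).L (S.s n).hL tf tf_lip q hq0 (x, 0)
  have e1 : ∑ i ∈ Finset.range q, tf (S.F (n+1) i (x, 0)) = ∑ j ∈ Finset.range q, tf ((S.s n).h.e (Rt (j / q) (x, 0))) := by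
    simp_rw [hF]
    refine Eq.trans ?_ (hp.trans ?_)
    · refine Finset.sum_congr rfl fun j _ => ?_
      simp [Rt, St.r, hq]
    · refine Finset.sum_congr rfl fun j _ => ?_
      simp [Rt]
  have hcl : |∑ i ∈ Finset.range q, tf (S.T^[i] (x, 0)) - ∑ i ∈ Finset.range q, tf (S.F (n+1) i (x, 0))| ≤ q * (1/2)^n := by
    rw [← Finset.sum_sub_distrib]
    refine (Finset.abs_sum_le_sum_abs _ _).trans ?_
    refine (Finset.sum_le_sum (g := fun _ => ((1:ℝ)/2)^n) fun i hi => ?_).trans (by simp)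
    have hi' : i ≤ S.M (n+1) := (Finset.mem_range.1 hi).le.trans (Nat.le_mul_of_pos_left _ (by positivity))
    have d := S.G_dist (n+1) i (by rw [Int.cast_natCast, abs_of_nonneg (by positivity)]; exact_mod_cast hi') (x, 0)
    have l := tf_lip.dist_le_mul (S.F (n+1) i (x, 0)) (S.G i (x, 0))
    rw [NNReal.coe_one, one_mul, Real.dist_eq, abs_sub_comm] at l
    rw [T_iter]
    refine l.trans (d.trans (le_of_eq ?_))
    rw [pow_succ]; ring
  have hL := S.L_q' n
  rw [← hq, div_le_iff₀ hq0'] at hL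
  have hP := S.Psi_small n
  have hP2 : (q:ℝ) * Psi (S.s n).h tf 0 ≤ q * (1/32) := by gcongr
  unfold av
  rw [inv_mul_le_iff₀ hq0']
  rw [e1] at hcl
  rw [abs_le] at hcl hs
  have := hcl.2
  have := hs.2
  change _ - (q:ℝ) * Psi (S.s n).h tf 0 ≤ _ at this
  linarith

lemma Z_nongeneric (x : UnitAddCircle) (hx : x ∈ S.Z) : ((x, 0) : Torus2) ∈ S.NB := by
  intro hg
  have h1 := hg ⟨tf, tf_lip.continuous⟩
  change Tendsto (av S.T (x, 0) tf) atTop (𝓝 (∫ y, tf y)) at h1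
  have hq : Tendsto (fun n => (S.s (n+1)).P.q) atTop atTop :=
    tendsto_atTop_mono (fun n => (Nat.le_succ n).trans (S.q_ge (n+1))) tendsto_id
  have h2 := h1.comp hq
  have h3 : Tendsto (fun n : ℕ => 1/32 + 2 * ((1:ℝ)/2) ^ n) atTop (𝓝 (1/32)) := by
    have := ((tendsto_pow_atTop_nhds_zero_of_lt_one (r := (1:ℝ)/2) (by norm_num) (by norm_num)).const_mul 2).const_add (1/32)
    simpa using this
  have := le_of_tendsto_of_tendsto' h2 h3 (fun n => S.av_small x hx n)
  linarith [tf_int]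

lemma le_dim : 1 ≤ dimH S.NB := by
  have hZ : volume S.Z ≠ 0 := by
    intro h0
    have h1 := S.Z_vol
    rw [prob_compl_eq_one_sub S.Z_meas, h0, tsub_zero, ENNReal.one_le_ofReal] at h1
    norm_num at h1
  have hi : Isometry (fun x : UnitAddCircle => ((x, 0) : Torus2)) := by
    intro x y
    simp [Prod.edist_eq]
  have := one_le_dimH _ hZ
  rw [← hi.dimH_image] at this
  refine this.trans (dimH_mono ?_)
  rintro _ ⟨x, hx, rfl⟩
  exact S.Z_nongeneric x hx

end Sq

/-- **Theorem E.** For any `1 < α < 2` there is an ergodic C^∞ μ-preserving diffeomorphism `T`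
of `𝕋²` such that the set `NB_α` of all points that are NOT generic points of `T` for the
Lebesgue measure `μ` satisfies `α − 1 ≤ dim_H NB_α ≤ α` and `μ(NB_α) = 0`. -/
theorem nongeneric_points_hausdorff_dim_interval (α : ℝ) (hα1 : 1 < α) (hα2 : α < 2) :
    ∃ T : SmoothMPTorusDiffeo,
      IsErgodicWrt T.toEquiv volume ∧
      ENNReal.ofReal (α - 1) ≤ dimH {x : Torus2 | ¬ IsGenericPt T.toEquiv volume x} ∧
      dimH {x : Torus2 | ¬ IsGenericPt T.toEquiv volume x} ≤ ENNReal.ofReal α ∧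
      volume {x : Torus2 | ¬ IsGenericPt T.toEquiv volume x} = 0 := by
  have ⟨s, h0, hs⟩ := exists_seq α hα1
  let S : Sq α := ⟨s, h0, hs⟩
  refine ⟨S.D, S.ergodic, le_trans ?_ S.le_dim, S.dim_le hα1, S.NB_vol⟩
  rw [ENNReal.ofReal_le_one]
  linarith
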